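/- Every mass distribution μ on ℝ¹³ admits an equipartition into 44 = 11×2×2 boxes by a collection of 10 parallel hyperplanes and two additional non-parallel hyperplanes: there exist a unit vector u ∈ ℝ¹³, real numbers t_1 < t_2 < ... < t_{10}, unit vectors v and w, and real numbers s₁, s₂, with u, v, w pairwise non-parallel (no two equal up to sign), such that each of the 44 regions {x : t_i < ⟨x,u⟩ < t_{i+1}} ∩ {x : ⟨x,v⟩ ≶ s₁} ∩ {x : ⟨x,w⟩ ≶ s₂} (for 0 ≤ i ≤ 10, with t_0 = -∞, t_{11} = +∞, and all four sign choices) has μ-measure μ(ℝ¹³)/44. -/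

import Mathlib

open MeasureTheory

/-- The open slab between consecutive parallel hyperplanes orthogonal to `u`:
for `0 ≤ i ≤ n`, the region `{x : t i < ⟪x,u⟫ < t (i+1)}`, with the conventions
`t 0 = -∞` and `t (n+1) = +∞` (i.e. the corresponding inequality is dropped). -/
noncomputable def slab {d : ℕ} (u : EuclideanSpace ℝ (Fin d)) (t : ℕ → ℝ) (n i : ℕ) :
    Set (EuclideanSpace ℝ (Fin d)) :=
  {x | (1 ≤ i → t i < (inner ℝ x u : ℝ)) ∧ (i + 1 ≤ n → (inner ℝ x u : ℝ) < t (i + 1))}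

/-- The open halfspace below (`b = true`) or above (`b = false`) the hyperplane
orthogonal to `v` at level `s`. -/
def halfSp {d : ℕ} (v : EuclideanSpace ℝ (Fin d)) (s : ℝ) (b : Bool) :
    Set (EuclideanSpace ℝ (Fin d)) :=
  if b then {x | (inner ℝ x v : ℝ) < s} else {x | s < (inner ℝ x v : ℝ)}


namespace EP

/-! ### Cochains modulo two on sequences -/

/-- Word of 1-cochains followed by a tail cochain. -/
def W {V : Type*} : List (V → V → ZMod 2) → ((ℕ → V) → ZMod 2) → (ℕ → V) → ZMod 2
  | [], T, s => T s
  | e :: l, T, s => e (s 0) (s 1) * W l T (fun k => s (k + 1))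

/-- Face operator on sequences. -/
def del {V : Type*} (i : ℕ) (s : ℕ → V) : ℕ → V := fun k => if k < i then s k else s (k + 1)

/-- Coboundary of an `n`-cochain. -/
def cobd {V : Type*} (n : ℕ) (T : (ℕ → V) → ZMod 2) (s : ℕ → V) : ZMod 2 :=
  ∑ i ∈ Finset.range (n + 2), T (del i s)

def Cocyc {V : Type*} (e : V → V → ZMod 2) : Prop := ∀ x y z, e x y + e y z = e x z

lemma two_eq_zero' (x : ZMod 2) : x + x = 0 := CharTwo.add_self_eq_zero x

section
variable {V : Type*}

lemma del_zero (s : ℕ → V) : del 0 s = fun k => s (k + 1) := by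
  funext k; simp [del]

lemma del_succ_zero (i : ℕ) (s : ℕ → V) : del (i + 1) s 0 = s 0 := by simp [del]

lemma shift_del_succ (i : ℕ) (s : ℕ → V) :
    (fun k => del (i + 1) s (k + 1)) = del i (fun k => s (k + 1)) := by
  funext k; simp [del]

lemma cobd_eq (n : ℕ) (T : (ℕ → V) → ZMod 2) (s : ℕ → V) :
    cobd n T s = T (fun k => s (k + 1)) + ∑ i ∈ Finset.range (n + 1), T (del (i + 1) s) := by
  rw [cobd, Finset.sum_range_succ', del_zero, add_comm]

lemma cobd_cup (n : ℕ) (e : V → V → ZMod 2) (T : (ℕ → V) → ZMod 2) (s : ℕ → V) :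
    cobd (n + 1) (fun s => e (s 0) (s 1) * T (fun k => s (k + 1))) s =
      (e (s 1) (s 2) + e (s 0) (s 2) + e (s 0) (s 1)) * T (fun k => s (k + 2)) +
      e (s 0) (s 1) * cobd n T (fun k => s (k + 1)) := by
  rw [cobd_eq, cobd_eq, Finset.sum_range_succ']
  have h1 : ∀ i, (fun s : ℕ → V => e (s 0) (s 1) * T (fun k => s (k + 1))) (del (i + 1 + 1) s)
      = e (s 0) (s 1) * T (del (i + 1) (fun k => s (k + 1))) := by
    intro i
    simp only [shift_del_succ]
    simp [del]
  have h2 : (fun s : ℕ → V => e (s 0) (s 1) * T (fun k => s (k + 1))) (del (0 + 1) s)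
      = e (s 0) (s 2) * T (fun k => s (k + 2)) := by
    simp only [shift_del_succ, del_zero]
    simp [del]
  beta_reduce at h2
  rw [Finset.sum_congr rfl (fun i _ => h1 i), h2, ← Finset.mul_sum]
  have h3 := two_eq_zero' (e (s 0) (s 1) * T (fun k => s (k + 2)))
  simp only [zero_add]
  linear_combination -h3

lemma W_zero (l : List (V → V → ZMod 2)) (s : ℕ → V) : W l (fun _ => 0) s = 0 := by
  induction l generalizing s with
  | nil => rfl
  | cons e l ih => simp [W, ih]

lemma W_append (l l' : List (V → V → ZMod 2)) (T : (ℕ → V) → ZMod 2) :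
    W (l ++ l') T = W l (W l' T) := by
  induction l with
  | nil => rfl
  | cons e l ih => funext s; simp [W, ih]

lemma W_add (l : List (V → V → ZMod 2)) (T T' : (ℕ → V) → ZMod 2) (s : ℕ → V) :
    W l (fun s => T s + T' s) s = W l T s + W l T' s := by
  induction l generalizing s with
  | nil => rfl
  | cons e l ih => simp [W, ih, mul_add]

lemma cobd_W (l : List (V → V → ZMod 2)) (hl : ∀ e ∈ l, Cocyc e) (n : ℕ)
    (T : (ℕ → V) → ZMod 2) (s : ℕ → V) :
    cobd (l.length + n) (W l T) s = W l (cobd n T) s := by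
  induction l generalizing s with
  | nil => simp only [List.length_nil, zero_add]; rfl
  | cons e l ih =>
    have h : (e :: l).length + n = (l.length + n) + 1 := by simp; omega
    rw [h]
    have h2 : W (e :: l) T = (fun s => e (s 0) (s 1) * W l T (fun k => s (k + 1))) := rfl
    rw [h2, cobd_cup, ih (fun e he => hl e (by simp [he]))]
    have h3 := hl e (by simp) (s 0) (s 1) (s 2)
    have : e (s 1) (s 2) + e (s 0) (s 2) + e (s 0) (s 1) = 0 := by
      rw [← h3]; linear_combination two_eq_zero' (e (s 0) (s 1)) + two_eq_zero' (e (s 1) (s 2))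
    rw [this, zero_mul, zero_add]; rfl

lemma cobd_W_one (l : List (V → V → ZMod 2)) (hl : ∀ e ∈ l, Cocyc e) (s : ℕ → V) :
    cobd l.length (W l (fun _ => 1)) s = 0 := by
  have := cobd_W l hl 0 (fun _ => 1) s
  rw [add_zero] at this
  rw [this]
  have : cobd 0 (fun _ : ℕ → V => (1 : ZMod 2)) = fun _ => 0 := by
    funext s; simp [cobd]; rfl
  rw [this, W_zero]

/-- inserting an invariant 0-cochain -/
lemma cobd_insert (l l' : List (V → V → ZMod 2)) (hl : ∀ e ∈ l, Cocyc e) (hl' : ∀ e ∈ l', Cocyc e)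
    (k : V → ZMod 2) (s : ℕ → V) :
    cobd (l.length + l'.length) (W l (fun s => k (s 0) * W l' (fun _ => 1) s)) s
      = W (l ++ (fun x y => k x + k y) :: l') (fun _ => 1) s := by
  rw [cobd_W l hl, W_append]
  congr 1
  funext s
  rw [cobd_eq]
  have h := cobd_W_one l' hl' s
  rw [cobd_eq] at h
  simp only [del_succ_zero]
  rw [← Finset.mul_sum]
  simp only [W]
  linear_combination k (s 0) * h - k (s 0) * two_eq_zero' (W l' (fun _ => 1) (fun k => s (k+1)))

lemma cobd_swap (l l' : List (V → V → ZMod 2)) (hl : ∀ e ∈ l, Cocyc e) (hl' : ∀ e ∈ l', Cocyc e)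
    (a b : V → V → ZMod 2) (ha : Cocyc a) (hb : Cocyc b) (s : ℕ → V) :
    cobd (l.length + (l'.length + 1)) (W (l ++ (fun x y => a x y * b x y) :: l') (fun _ => 1)) s
      = W (l ++ a :: b :: l') (fun _ => 1) s + W (l ++ b :: a :: l') (fun _ => 1) s := by
  rw [W_append, cobd_W l hl, W_append, W_append, ← W_add]
  congr 1
  funext s
  have h2 : W ((fun x y => a x y * b x y) :: l') (fun _ => 1) =
    (fun s => (fun x y => a x y * b x y) (s 0) (s 1) * W l' (fun _ => 1) (fun k => s (k + 1))) := rfl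
  rw [h2, cobd_cup l'.length (fun x y => a x y * b x y), cobd_W_one l' hl']
  simp only [W, ← ha (s 0) (s 1) (s 2), ← hb (s 0) (s 1) (s 2)]
  have e1 := two_eq_zero' (a (s 0) (s 1) * b (s 0) (s 1))
  have e2 := two_eq_zero' (a (s 1) (s 2) * b (s 1) (s 2))
  linear_combination W l' (fun _ => 1) (fun k => s (k + 2)) * (e1 + e2)

lemma W_local (l : List (V → V → ZMod 2)) (T : (ℕ → V) → ZMod 2) (n : ℕ)
    (hT : ∀ s s' : ℕ → V, (∀ k ≤ n, s k = s' k) → T s = T s') (s s' : ℕ → V)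
    (h : ∀ k ≤ l.length + n, s k = s' k) : W l T s = W l T s' := by
  induction l generalizing s s' with
  | nil => exact hT s s' (fun k hk => h k (by simpa using hk))
  | cons e l ih =>
    simp only [W]
    have hlen : (e :: l).length = l.length + 1 := by simp
    rw [h 0 (by omega), h 1 (by omega), ih (fun k => s (k+1)) (fun k => s' (k+1))]
    intro k hk; exact h _ (by omega)

lemma W_inv (g : V → V) (l : List (V → V → ZMod 2)) (hl : ∀ e ∈ l, ∀ x y, e (g x) (g y) = e x y)
    (T : (ℕ → V) → ZMod 2) (hT : ∀ s, T (fun k => g (s k)) = T s) (s : ℕ → V) :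
    W l T (fun k => g (s k)) = W l T s := by
  induction l generalizing s with
  | nil => exact hT s
  | cons e l ih =>
    simp only [W]
    rw [hl e (by simp), ih (fun e he => hl e (by simp [he])) (fun k => s (k+1))]

lemma W_eq_zero (l l' : List (V → V → ZMod 2)) (e : V → V → ZMod 2) (T : (ℕ → V) → ZMod 2)
    (s : ℕ → V) (h : e (s l.length) (s (l.length + 1)) = 0) : W (l ++ e :: l') T s = 0 := by
  induction l generalizing s with
  | nil => simp [W] at h ⊢; simp [h]
  | cons a l ih =>
    simp only [List.cons_append, W]
    rw [ih, mul_zero]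
    simpa using h

end
end EP

namespace EP

/-! ### Abstract thin systems with a `(Z/2)^3` action -/

/-- Maximal chains. -/
def IsCh {V : Type*} (R : V → V → Prop) {n : ℕ} (σ : Fin (n + 2) → V) : Prop :=
  ∀ j : Fin (n + 1), R (σ j.castSucc) (σ j.succ)

structure Sys (V : Type) [Fintype V] [DecidableEq V] (n : ℕ) where
  R : V → V → Prop
  act : (Fin 3 → ZMod 2) → V → V
  A : V → Fin 3 → ZMod 2
  act_act : ∀ g x, act g (act g x) = x
  A_act : ∀ g x, A (act g x) = A x + g
  R_act : ∀ g x y, R x y → R (act g x) (act g y)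
  flip : ∀ σ : Fin (n + 2) → V, IsCh R σ → ∀ i, ∃! x, x ≠ σ i ∧ IsCh R (Function.update σ i x)

def sq {V : Type*} {n : ℕ} (σ : Fin (n + 2) → V) : ℕ → V := fun k => σ (Fin.ofNat (n + 2) k)

set_option linter.unusedSectionVars false
section
variable {V : Type} [Fintype V] [DecidableEq V] {n : ℕ} (S : Sys V n)

def ind (x : V) : ZMod 2 := if S.A x = 0 then 1 else 0

open Classical in
noncomputable def tot (Φ : (ℕ → V) → ZMod 2) : ZMod 2 :=
  ∑ σ : Fin (n + 2) → V with IsCh S.R σ, ind S (σ 0) * Φ (sq σ)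

open Classical in
lemma pair_zero (i : Fin (n + 2)) (F : (Fin (n + 2) → V) → ZMod 2)
    (hF : ∀ σ x, F (Function.update σ i x) = F σ) :
    ∑ σ : Fin (n + 2) → V with IsCh S.R σ, F σ = 0 := by
  have key : ∀ σ : Fin (n + 2) → V, ∃ x, IsCh S.R σ → (x ≠ σ i ∧ IsCh S.R (Function.update σ i x)) := by
    intro σ
    by_cases h : IsCh S.R σ
    · obtain ⟨x, hx, _⟩ := S.flip σ h i
      exact ⟨x, fun _ => hx⟩
    · exact ⟨σ i, fun h' => absurd h' h⟩
  choose f hf using key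
  refine Finset.sum_involution (fun σ _ => Function.update σ i (f σ)) ?_ ?_ ?_ ?_
  · intro σ _
    rw [hF]; exact two_eq_zero' _
  · intro σ hσ _ h
    have := congrFun h i
    simp only [Function.update_self] at this
    exact (hf σ (by simpa using hσ)).1 this
  · intro σ hσ
    simpa using (hf σ (by simpa using hσ)).2
  · intro σ hσ
    have hc : IsCh S.R σ := by simpa using hσ
    have h1 := hf σ hc
    have h2 := hf _ h1.2
    rw [Function.update_idem]
    obtain ⟨y, _, hu⟩ := S.flip _ h1.2 i
    have e1 := hu _ h2
    have e2 := hu (σ i) (by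
      simp only [Function.update_self, Function.update_idem, Function.update_eq_self]
      exact ⟨h1.1.symm, hc⟩)
    rw [e1, ← e2, Function.update_eq_self]

lemma ind_sum (x : V) : ∑ g, ind S (S.act g x) = 1 := by
  have : ∀ g, ind S (S.act g x) = if g = - S.A x then 1 else 0 := by
    intro g
    unfold ind
    rw [S.A_act]
    congr 1
    rw [add_comm, add_eq_zero_iff_eq_neg]
  simp [this]

lemma isCh_act (g : Fin 3 → ZMod 2) (σ : Fin (n + 2) → V) (h : IsCh S.R σ) :
    IsCh S.R (fun k => S.act g (σ k)) := fun j => S.R_act g _ _ (h j)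

open Classical in
lemma ind_move (F : (Fin (n + 2) → V) → ZMod 2)
    (hF : ∀ g σ, F (fun k => S.act g (σ k)) = F σ) (i j : Fin (n + 2)) :
    ∑ σ : Fin (n + 2) → V with IsCh S.R σ, ind S (σ i) * F σ =
    ∑ σ : Fin (n + 2) → V with IsCh S.R σ, ind S (σ j) * F σ := by
  have h1 : ∀ i j : Fin (n + 2), ∑ σ : Fin (n + 2) → V with IsCh S.R σ, ind S (σ i) * F σ =
    ∑ g, ∑ σ : Fin (n + 2) → V with IsCh S.R σ, ind S (σ i) * ind S (S.act g (σ j)) * F σ := by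
    intro i j
    rw [Finset.sum_comm]
    refine Finset.sum_congr rfl fun σ _ => ?_
    rw [← Finset.sum_mul, ← Finset.mul_sum, ind_sum, mul_one]
  rw [h1 i j, h1 j i]
  refine Finset.sum_congr rfl fun g _ => ?_
  refine Finset.sum_bij' (fun σ _ => fun k => S.act g (σ k)) (fun σ _ => fun k => S.act g (σ k))
    ?_ ?_ ?_ ?_ ?_
  · intro σ hσ; simpa using isCh_act S g σ (by simpa using hσ)
  · intro σ hσ; simpa using isCh_act S g σ (by simpa using hσ)
  · intro σ _; funext k; exact S.act_act g _
  · intro σ _; funext k; exact S.act_act g _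
  · intro σ _
    rw [hF, S.act_act]; ring

lemma tot_cobd (Φ : (ℕ → V) → ZMod 2)
    (hloc : ∀ s s' : ℕ → V, (∀ k ≤ n, s k = s' k) → Φ s = Φ s')
    (hinv : ∀ g s, Φ (fun k => S.act g (s k)) = Φ s) : tot S (cobd n Φ) = 0 := by
  classical
  unfold tot cobd
  simp only [Finset.mul_sum]
  rw [Finset.sum_comm]
  refine Finset.sum_eq_zero fun i hi => ?_
  have hi' : i < n + 2 := by simpa using hi
  have hF : ∀ (σ : Fin (n + 2) → V) x,
      Φ (del i (sq (Function.update σ ⟨i, hi'⟩ x))) = Φ (del i (sq σ)) := by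
    intro σ x
    apply hloc
    intro k hk
    unfold del sq
    split_ifs with h
    · rw [Function.update_of_ne]
      intro h'
      have := congrArg Fin.val h'
      simp [Fin.ofNat] at this
      rw [Nat.mod_eq_of_lt (by omega)] at this
      omega
    · rw [Function.update_of_ne]
      intro h'
      have := congrArg Fin.val h'
      simp [Fin.ofNat] at this
      rw [Nat.mod_eq_of_lt (by omega)] at this
      omega
  have hG : ∀ g (σ : Fin (n + 2) → V), Φ (del i (sq (fun k => S.act g (σ k)))) = Φ (del i (sq σ)) := by
    intro g σ
    rw [← hinv g (del i (sq σ))]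
    congr 1
    funext k
    unfold del sq
    split_ifs <;> rfl
  rcases Nat.eq_zero_or_pos i with h0 | h0
  · rw [ind_move S (fun σ => Φ (del i (sq σ))) hG 0 1]
    refine pair_zero S ⟨i, hi'⟩ _ ?_
    intro σ x
    rw [hF, Function.update_of_ne]
    intro h; have := congrArg Fin.val h; simp at this; omega
  · refine pair_zero S ⟨i, hi'⟩ (fun σ => ind S (σ 0) * Φ (del i (sq σ))) ?_
    intro σ x
    rw [hF, Function.update_of_ne]
    intro h; have := congrArg Fin.val h; simp at this; omega

lemma tot_add (Φ Ψ : (ℕ → V) → ZMod 2) :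
    tot S (fun s => Φ s + Ψ s) = tot S Φ + tot S Ψ := by
  simp [tot, mul_add, Finset.sum_add_distrib]

/-- good 1-cochains -/
def Good (e : V → V → ZMod 2) : Prop := Cocyc e ∧ ∀ g x y, e (S.act g x) (S.act g y) = e x y

noncomputable def T (l : List (V → V → ZMod 2)) : ZMod 2 := tot S (W l (fun _ => 1))

lemma T_insert (l l' : List (V → V → ZMod 2)) (hl : ∀ e ∈ l, Good S e) (hl' : ∀ e ∈ l', Good S e)
    (hlen : l.length + l'.length = n) (k : V → ZMod 2) (hk : ∀ g x, k (S.act g x) = k x) :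
    T S (l ++ (fun x y => k x + k y) :: l') = 0 := by
  rw [T, ← funext (cobd_insert l l' (fun e he => (hl e he).1) (fun e he => (hl' e he).1) k), hlen]
  apply tot_cobd
  · intro s s' h
    refine W_local l _ l'.length ?_ s s' (by rwa [hlen])
    intro s s' h
    rw [h 0 (by omega), W_local l' _ 0 (fun _ _ _ => rfl) s s' (by simpa using h)]
  · intro g s
    apply W_inv _ _ (fun e he => (hl e he).2 g)
    intro s
    rw [hk, W_inv _ _ (fun e he => (hl' e he).2 g) _ (fun _ => rfl)]

lemma T_swap (l l' : List (V → V → ZMod 2)) (hl : ∀ e ∈ l, Good S e) (hl' : ∀ e ∈ l', Good S e)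
    (hlen : l.length + (l'.length + 1) = n) (a b : V → V → ZMod 2) (ha : Good S a) (hb : Good S b) :
    T S (l ++ a :: b :: l') = T S (l ++ b :: a :: l') := by
  have h : T S (l ++ a :: b :: l') + T S (l ++ b :: a :: l') = 0 := by
    rw [T, T, ← tot_add, ← funext (cobd_swap l l' (fun e he => (hl e he).1)
      (fun e he => (hl' e he).1) a b ha.1 hb.1), hlen]
    apply tot_cobd
    · intro s s' h
      refine W_local _ _ 0 (fun _ _ _ => rfl) s s' ?_
      simpa [hlen] using h
    · intro g s
      apply W_inv _ _ _ _ (fun _ => rfl)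
      intro e he x y
      simp only [List.mem_append, List.mem_cons] at he
      rcases he with he | rfl | he
      · exact (hl e he).2 g x y
      · simp only [ha.2, hb.2]
      · exact (hl' e he).2 g x y
  exact CharTwo.add_eq_zero.mp h

lemma T_perm (l₁ l₂ : List (V → V → ZMod 2)) (hp : l₁.Perm l₂) (p : List (V → V → ZMod 2))
    (h : ∀ e ∈ p ++ l₁, Good S e) (hlen : (p ++ l₁).length = n + 1) :
    T S (p ++ l₁) = T S (p ++ l₂) := by
  induction hp generalizing p with
  | nil => rfl
  | cons x _ ih =>
    have := ih (p ++ [x]) (by simpa using h) (by simpa using hlen)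
    simpa using this
  | swap x y l =>
    refine T_swap S p l (fun e he => h e (by simp [he])) (fun e he => h e (by simp [he])) ?_ _ _
      (h _ (by simp)) (h _ (by simp))
    simp at hlen ⊢; omega
  | trans h1 h2 ih1 ih2 =>
    rw [ih1 p h hlen]
    refine ih2 p ?_ ?_
    · intro e he; apply h; simp only [List.mem_append] at he ⊢; rwa [h1.mem_iff]
    · simpa [h1.length_eq] using hlen

lemma W_lin (l l' : List (V → V → ZMod 2)) (e : Fin 3 → V → V → ZMod 2) (c : Fin 3 → ZMod 2)
    (U : (ℕ → V) → ZMod 2) (s : ℕ → V) :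
    W (l ++ (fun x y => ∑ i, c i * e i x y) :: l') U s = ∑ i, c i * W (l ++ e i :: l') U s := by
  induction l generalizing s with
  | nil => simp only [List.nil_append, W, Finset.sum_mul, mul_assoc]
  | cons a l ih =>
    simp only [List.cons_append, W, ih, Finset.mul_sum]
    exact Finset.sum_congr rfl fun i _ => by ring

lemma T_lin (l l' : List (V → V → ZMod 2)) (e : Fin 3 → V → V → ZMod 2) (c : Fin 3 → ZMod 2) :
    T S (l ++ (fun x y => ∑ i, c i * e i x y) :: l') = ∑ i, c i * T S (l ++ e i :: l') := by
  simp only [T, tot, Finset.mul_sum, W_lin]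
  rw [Finset.sum_comm]
  exact Finset.sum_congr rfl fun i _ => Finset.sum_congr rfl fun _ _ => by ring

lemma W_addmid (l l' : List (V → V → ZMod 2)) (e e' : V → V → ZMod 2)
    (U : (ℕ → V) → ZMod 2) (s : ℕ → V) :
    W (l ++ (fun x y => e x y + e' x y) :: l') U s =
      W (l ++ e :: l') U s + W (l ++ e' :: l') U s := by
  induction l generalizing s with
  | nil => simp only [List.nil_append, W]; ring
  | cons a l ih => simp only [List.cons_append, W, ih]; ring

lemma T_addmid (l l' : List (V → V → ZMod 2)) (e e' : V → V → ZMod 2) :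
    T S (l ++ (fun x y => e x y + e' x y) :: l') = T S (l ++ e :: l') + T S (l ++ e' :: l') := by
  rw [T, T, T, ← tot_add]
  congr 1
  funext s
  rw [W_addmid]

/-- letter cochains -/
def al (i : Fin 3) : V → V → ZMod 2 := fun x y => S.A x i + S.A y i

lemma cocyc_d (k : V → ZMod 2) : Cocyc (fun x y => k x + k y) := by
  intro x y z
  linear_combination two_eq_zero' (k y)

lemma good_d (k : V → ZMod 2) (c : (Fin 3 → ZMod 2) → ZMod 2)
    (hk : ∀ g x, k (S.act g x) = k x + c g) : Good S (fun x y => k x + k y) := by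
  refine ⟨cocyc_d k, fun g x y => ?_⟩
  simp only [hk]
  linear_combination two_eq_zero' (c g)

lemma good_al (i : Fin 3) : Good S (al S i) :=
  good_d S (fun x => S.A x i) (fun g => g i) (fun g x => by simp [S.A_act])

/-- linear forms -/
def lf (c : Fin 3 → ZMod 2) : V → V → ZMod 2 := fun x y => ∑ i, c i * al S i x y

def lk (c : Fin 3 → ZMod 2) : V → ZMod 2 := fun x => ∑ i, c i * S.A x i

lemma lf_eq (c : Fin 3 → ZMod 2) : lf S c = fun x y => lk S c x + lk S c y := by
  funext x y
  simp [lf, lk, al, mul_add, Finset.sum_add_distrib]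

lemma lk_act (c : Fin 3 → ZMod 2) (g x) : lk S c (S.act g x) = lk S c x + ∑ i, c i * g i := by
  simp [lk, S.A_act, mul_add, Finset.sum_add_distrib]

lemma good_lf (c : Fin 3 → ZMod 2) : Good S (lf S c) := by
  rw [lf_eq]; exact good_d S _ _ (lk_act S c)

lemma T_replace (L : List ((V → ZMod 2) × (Fin 3 → ZMod 2)))
    (hL : ∀ p ∈ L, ∀ g x, p.1 (S.act g x) = p.1 x + ∑ i, p.2 i * g i)
    (l : List (V → V → ZMod 2)) (hl : ∀ e ∈ l, Good S e) (hlen : l.length + L.length = n + 1) :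
    T S (l ++ L.map (fun p => fun x y => p.1 x + p.1 y)) = T S (l ++ L.map (fun p => lf S p.2)) := by
  induction L generalizing l with
  | nil => rfl
  | cons p L ih =>
    have h1 : (fun x y => p.1 x + p.1 y) = fun x y => lf S p.2 x y +
        (fun x y => (p.1 x + lk S p.2 x) + (p.1 y + lk S p.2 y)) x y := by
      funext x y
      rw [lf_eq]
      linear_combination - two_eq_zero' (lk S p.2 x) - two_eq_zero' (lk S p.2 y)
    have hg : ∀ e ∈ L.map (fun p : (V → ZMod 2) × (Fin 3 → ZMod 2) => fun x y => p.1 x + p.1 y),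
        Good S e := by
      intro e he
      obtain ⟨q, hq, rfl⟩ := List.mem_map.1 he
      exact good_d S q.1 _ (hL q (by simp [hq]))
    rw [List.map_cons, h1, T_addmid, T_insert S l _ hl hg (by simp at hlen ⊢; omega), add_zero]
    · have := ih (fun q hq => hL q (by simp [hq])) (l ++ [lf S p.2]) (by
        intro e he
        simp only [List.mem_append, List.mem_singleton] at he
        rcases he with he | rfl
        · exact hl e he
        · exact good_lf S _) (by simp at hlen ⊢; omega)
      simpa using this
    · intro g x
      rw [hL p (by simp), lk_act]
      linear_combination two_eq_zero' (∑ i, p.2 i * g i)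

open MvPolynomial in
lemma T_coeff (e : Fin 3 →₀ ℕ)
    (h0 : ∀ l : List (Fin 3), l.length = n + 1 →
      T S (l.map (al S)) = MvPolynomial.coeff e ((l.map (fun i => (X i : MvPolynomial (Fin 3) (ZMod 2)))).prod))
    (L : List (Fin 3 → ZMod 2)) (l : List (Fin 3)) (hlen : l.length + L.length = n + 1) :
    T S (l.map (al S) ++ L.map (lf S)) =
      MvPolynomial.coeff e ((l.map (fun i => (X i : MvPolynomial (Fin 3) (ZMod 2)))).prod *
        (L.map (fun c => ∑ i, C (c i) * X i)).prod) := by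
  induction L generalizing l with
  | nil => simpa using h0 l (by simpa using hlen)
  | cons c L ih =>
    have h1 := T_lin S (l.map (al S)) (L.map (lf S)) (al S) c
    rw [List.map_cons]
    change T S (l.map (al S) ++ (fun x y => ∑ i, c i * al S i x y) :: L.map (lf S)) = _
    rw [h1]
    have h2 : ∀ i, T S (l.map (al S) ++ al S i :: L.map (lf S)) =
        MvPolynomial.coeff e (((l ++ [i]).map (fun i => (X i : MvPolynomial (Fin 3) (ZMod 2)))).prod *
        (L.map (fun c => ∑ i, C (c i) * X i)).prod) := fun i => by
      have := ih (l ++ [i]) (by simp at hlen ⊢; omega)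
      rw [List.map_append, List.append_assoc] at this
      exact this
    simp only [h2, List.map_append, List.map_cons, List.map_nil, List.prod_append, List.prod_cons,
      List.prod_nil, mul_one, Finset.sum_mul, Finset.mul_sum, coeff_sum]
    refine Finset.sum_congr rfl fun i _ => ?_
    rw [← coeff_C_mul]
    congr 1
    ring

end
end EP

namespace EP

/-! ### The cubical grid on a product of three spheres -/

abbrev Raw (m : ℕ) := Fin 3 × Fin (m + 1) → ℤ

def IsCell (m N : ℕ) (c : Raw m) : Prop :=
  (∀ p, |c p| ≤ 2 * N) ∧ ∀ i, ∃ k, |c (i, k)| = 2 * N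

def St {m : ℕ} (c c' : Raw m) : Prop :=
  ∃ p, Even (c p) ∧ (c' p = c p + 1 ∨ c' p = c p - 1) ∧ ∀ q, q ≠ p → c' q = c q

abbrev Cell (m N : ℕ) := {c : Raw m // IsCell m N c}

instance (m N : ℕ) : Finite (Cell m N) := by
  have h : Set.Finite {c : Raw m | ∀ p, c p ∈ Set.Icc (-(2 * N : ℤ)) (2 * N)} :=
    Set.Finite.pi' (fun _ => Set.finite_Icc _ _)
  refine Set.Finite.subset h ?_
  intro c hc p
  exact abs_le.1 (hc.1 p)

noncomputable instance (m N : ℕ) : Fintype (Cell m N) := Fintype.ofFinite _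

/-- number of odd coordinates -/
def od {m : ℕ} (c : Raw m) : ℕ := (Finset.univ.filter (fun p => Odd (c p))).card

lemma od_st {m : ℕ} {c c' : Raw m} (h : St c c') : od c' = od c + 1 := by
  obtain ⟨p, he, hp, hq⟩ := h
  unfold od
  have hp' : Odd (c' p) := by
    rcases hp with h | h <;> rw [h]
    · exact he.add_one
    · exact he.sub_odd odd_one
  have : Finset.univ.filter (fun p => Odd (c' p)) =
      insert p (Finset.univ.filter (fun p => Odd (c p))) := by
    ext q
    simp only [Finset.mem_filter, Finset.mem_univ, true_and, Finset.mem_insert]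
    by_cases h : q = p
    · subst h; simp [hp']
    · simp [h, hq q h]
  rw [this, Finset.card_insert_of_notMem]
  simpa using he

lemma cell_even_card {m N : ℕ} {c : Raw m} (h : IsCell m N c) :
    ∃ K : Fin 3 → Fin (m + 1), (∀ i, |c (i, K i)| = 2 * N) ∧ od c ≤ 3 * m ∧
      (od c = 3 * m → ∀ p, Even (c p) → p.2 = K p.1) := by
  choose K hK using h.2
  refine ⟨K, hK, ?_⟩
  have hE : ∀ i, Even (c (i, K i)) := by
    intro i
    have : Even |c (i, K i)| := by rw [hK]; exact even_two_mul _
    exact even_abs.1 this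
  set E : Finset (Fin 3 × Fin (m + 1)) := Finset.univ.filter (fun p => ¬ Odd (c p)) with hEdef
  have hsum : od c + E.card = 3 * (m + 1) := by
    unfold od
    rw [hEdef, Finset.card_filter_add_card_filter_not]
    simp
  set I : Finset (Fin 3 × Fin (m + 1)) := Finset.univ.image (fun i => (i, K i)) with hI
  have hIc : I.card = 3 := by
    rw [hI, Finset.card_image_of_injective]
    · simp
    · intro a b h; exact (Prod.ext_iff.1 h).1
  have hsub : I ⊆ E := by
    intro p hp
    obtain ⟨i, _, rfl⟩ := Finset.mem_image.1 hp
    simp [hEdef, hE i]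
  have hle := Finset.card_le_card hsub
  refine ⟨by omega, fun ho p hp => ?_⟩
  have heq : I = E := Finset.eq_of_subset_of_card_le hsub (by omega)
  have : p ∈ I := by rw [heq]; simp [hEdef, hp]
  obtain ⟨i, _, rfl⟩ := Finset.mem_image.1 this
  rfl

lemma cell_of {m N : ℕ} {b x : Raw m} (hb : IsCell m N b) (h1 : ∀ p, |x p| ≤ 2 * N)
    (h2 : ∀ p, |b p| = 2 * N → |x p| = 2 * N) : IsCell m N x := by
  refine ⟨h1, fun i => ?_⟩
  obtain ⟨k, hk⟩ := hb.2 i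
  exact ⟨k, h2 _ hk⟩

lemma odd_ne {N : ℕ} {x : ℤ} (h : Odd x) : |x| ≠ 2 * N := by
  intro h'
  have : Odd |x| := odd_abs.2 h
  rw [h'] at this
  exact (Int.not_odd_iff_even.2 (even_two_mul _)) this

lemma odd_of_st {x y : ℤ} (he : Even x) (h : y = x + 1 ∨ y = x - 1) : Odd y := by
  rcases h with rfl | rfl
  · exact he.add_one
  · exact he.sub_odd odd_one

lemma flip_bot {m N : ℕ} {a b : Raw m} (ha : IsCell m N a) (hb : IsCell m N b) (h : St a b)
    (hev : ∀ p, Even (a p)) : ∃! x : Cell m N, x.1 ≠ a ∧ St x.1 b := by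
  obtain ⟨p, he, hp, hq⟩ := h
  have hob := odd_of_st he hp
  have hlt : |b p| < 2 * N := lt_of_le_of_ne (hb.1 p) (odd_ne hob)
  have hx : IsCell m N (Function.update b p (2 * b p - a p)) := by
    apply cell_of hb
    · intro q
      by_cases hqp : q = p
      · subst hqp
        rw [Function.update_self]
        rw [abs_lt] at hlt
        rw [abs_le]
        rcases hp with h | h <;> constructor <;> omega
      · rw [Function.update_of_ne hqp]; exact hb.1 q
    · intro q hq'
      by_cases hqp : q = p
      · subst hqp; exact absurd hq' (odd_ne hob)
      · rw [Function.update_of_ne hqp]; exact hq'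
  refine ⟨⟨_, hx⟩, ⟨?_, p, ?_, ?_, ?_⟩, ?_⟩
  · intro h
    have := congrFun h p
    simp only [Function.update_self] at this
    omega
  · simp only [Function.update_self]
    exact (even_two_mul _).sub he
  · simp only [Function.update_self]; omega
  · intro q hqp; simp only [Function.update_of_ne hqp]
  · rintro ⟨y, hy⟩ ⟨hne, p', he', hp', hq'⟩
    have hob' := odd_of_st he' hp'
    have hpp : p' = p := by
      by_contra hcon
      rw [hq p' hcon] at hob'
      exact (Int.not_odd_iff_even.2 (hev p')) hob'
    subst hpp
    apply Subtype.ext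
    funext q
    by_cases hqp : q = p'
    · subst hqp
      simp only [Function.update_self]
      simp only at hp'
      by_contra hcon
      apply hne
      funext r
      by_cases hr : r = q
      · subst hr; simp only; omega
      · have h1 := hq r hr
        have h2 := hq' r hr
        simp only at h2 ⊢
        omega
    · simp only [Function.update_of_ne hqp]
      exact (hq' q hqp).symm

lemma flip_mid {m N : ℕ} {a b c : Raw m} (ha : IsCell m N a) (hc : IsCell m N c) (h : St a b)
    (h' : St b c) : ∃! x : Cell m N, x.1 ≠ b ∧ St a x.1 ∧ St x.1 c := by
  obtain ⟨p, he, hp, hpq⟩ := h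
  obtain ⟨q, he', hq, hqp⟩ := h'
  have hob := odd_of_st he hp
  have hoc := odd_of_st he' hq
  have hne : q ≠ p := by
    rintro rfl; exact (Int.not_odd_iff_even.2 he') hob
  have hbq : b q = a q := hpq q hne
  have hcp : c p = b p := hqp p hne.symm
  have hx : IsCell m N (Function.update a q (c q)) := by
    apply cell_of hc
    · intro r
      by_cases hr : r = q
      · subst hr; rw [Function.update_self]; exact hc.1 r
      · rw [Function.update_of_ne hr]; exact ha.1 r
    · intro r hr
      by_cases hr' : r = q
      · subst hr'; rwa [Function.update_self]
      · rw [Function.update_of_ne hr']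
        by_cases hrp : r = p
        · subst hrp; rw [hcp] at hr; exact absurd hr (odd_ne hob)
        · rw [hqp r hr', hpq r hrp] at hr; exact hr
  refine ⟨⟨_, hx⟩, ⟨?_, ⟨q, ?_, ?_, ?_⟩, p, ?_, ?_, ?_⟩, ?_⟩
  · intro h
    have := congrFun h p
    simp only [Function.update_of_ne hne.symm] at this
    omega
  · rwa [← hbq]
  · simp only [Function.update_self]; omega
  · intro r hr; simp only [Function.update_of_ne hr]
  · simp only [Function.update_of_ne hne.symm]; exact he
  · simp only [Function.update_of_ne hne.symm]; omega
  · intro r hr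
    by_cases hr' : r = q
    · subst hr'; simp only [Function.update_self]
    · simp only [Function.update_of_ne hr']
      rw [hqp r hr', hpq r hr]
  · rintro ⟨y, hy⟩ ⟨hyb, ⟨p', e1, hp', hpq'⟩, q', e2, hq', hqp'⟩
    simp only at *
    have o1 := odd_of_st e1 hp'
    have hne' : q' ≠ p' := by
      rintro rfl; exact (Int.not_odd_iff_even.2 e2) o1
    -- p' is p or q
    have hp'c : p' = p ∨ p' = q := by
      by_contra! hcon
      have h1 := hqp p' hcon.2
      have h2 := hpq p' hcon.1
      have h3 := hqp' p' hne'.symm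
      omega
    have hpc : p' = p ∨ q' = p := by
      by_contra! hcon
      have h3 := hqp' p hcon.2.symm
      have h4 := hpq' p hcon.1.symm
      omega
    have hqc : p' = q ∨ q' = q := by
      by_contra! hcon
      have h3 := hqp' q hcon.2.symm
      have h4 := hpq' q hcon.1.symm
      omega
    rcases hp'c with rfl | rfl
    · exfalso
      apply hyb
      have hq'q : q' = q := by
        rcases hqc with h | h
        · exact absurd h.symm hne
        · exact h
      subst hq'q
      funext r
      by_cases hr : r = p'
      · subst hr
        have := hqp' r hne.symm
        omega
      · rw [hpq r hr, hpq' r hr]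
    · have hq'p : q' = p := by
        rcases hpc with h | h
        · exact absurd h hne
        · exact h
      subst hq'p
      apply Subtype.ext
      funext r
      by_cases hr : r = p'
      · subst hr
        simp only [Function.update_self]
        exact (hqp' r hne).symm
      · simp only [Function.update_of_ne hr]
        exact hpq' r hr

lemma flip_top {m N : ℕ} (hN : 1 ≤ N) {a b : Raw m} (ha : IsCell m N a) (hb : IsCell m N b) (h : St a b)
    (hod : od b = 3 * m) : ∃! x : Cell m N, x.1 ≠ b ∧ St a x.1 := by
  obtain ⟨K, hK, -, hKu⟩ := cell_even_card hb
  specialize hKu hod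
  obtain ⟨p, he, hp, hpq⟩ := h
  have hob := odd_of_st he hp
  set q : Fin 3 × Fin (m + 1) := (p.1, K p.1) with hqdef
  have hbq : |b q| = 2 * N := hK p.1
  have hqp : q ≠ p := by
    intro h; rw [h] at hbq; exact odd_ne hob hbq
  have haq : a q = b q := (hpq q hqp).symm
  have hqe : Even (a q) := by
    have : Even |a q| := by rw [haq, hbq]; exact even_two_mul _
    exact even_abs.1 this
  -- even coordinates of `a`
  have hev : ∀ r, Even (a r) → r.1 = p.1 → r = p ∨ r = q := by
    intro r hr hr1
    by_cases hrp : r = p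
    · exact Or.inl hrp
    · right
      have := hKu r (by rwa [hpq r hrp])
      rw [hqdef]; exact Prod.ext hr1 (by rw [this, hr1])
  -- a step of `a` to a cell
  have hstep : ∀ y : Raw m, IsCell m N y → ∀ r, Even (a r) → (y r = a r + 1 ∨ y r = a r - 1) →
      (∀ t, t ≠ r → y t = a t) → r = p ∨ (r = q ∧ |a p| = 2 * N) := by
    intro y hy r hr hyr hyt
    have hor := odd_of_st hr hyr
    obtain ⟨k, hk⟩ := hy.2 r.1
    have hkr : (r.1, k) ≠ r := by
      intro h; rw [h] at hk; exact odd_ne hor hk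
    rw [hyt _ hkr] at hk
    have hke : Even (a (r.1, k)) := by
      have : Even |a (r.1, k)| := by rw [hk]; exact even_two_mul _
      exact even_abs.1 this
    by_cases hr1 : r.1 = p.1
    · rcases hev r hr hr1 with h | h
      · exact Or.inl h
      · right
        refine ⟨h, ?_⟩
        rcases hev (r.1, k) hke hr1 with h' | h'
        · rwa [h'] at hk
        · exact absurd (h'.trans h.symm) hkr
    · exfalso
      apply hkr
      have e1 := hKu r (by rwa [hpq r (fun h => hr1 (by rw [h]))])
      have e2 := hKu (r.1, k) (by rwa [hpq _ (fun h => hr1 (by rw [← h]))])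
      exact Prod.ext rfl (by rw [e2, e1])
  by_cases hap : |a p| = 2 * N
  · -- move q inward
    set v : ℤ := if 0 < a q then a q - 1 else a q + 1 with hv
    have haq2 : |a q| = 2 * N := by rw [haq]; exact hbq
    have hvle : |v| ≤ 2 * N := by
      rw [hv]
      rcases abs_cases (a q) with ⟨h1, h2⟩ | ⟨h1, h2⟩ <;> split_ifs <;> rw [abs_le] <;> omega
    have hvst : v = a q + 1 ∨ v = a q - 1 := by rw [hv]; split_ifs <;> simp
    have hx : IsCell m N (Function.update a q v) := by
      refine ⟨?_, fun i => ?_⟩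
      · intro r
        by_cases hr : r = q
        · subst hr; rw [Function.update_self]; exact hvle
        · rw [Function.update_of_ne hr]; exact ha.1 r
      · by_cases hi : i = p.1
        · subst hi
          refine ⟨p.2, ?_⟩
          rw [Function.update_of_ne (fun h => hqp h.symm)]; exact hap
        · obtain ⟨k, hk⟩ := ha.2 i
          refine ⟨k, ?_⟩
          rw [Function.update_of_ne]
          · exact hk
          · intro h; exact hi (congrArg Prod.fst h)
    refine ⟨⟨_, hx⟩, ⟨?_, q, hqe, ?_, ?_⟩, ?_⟩
    · intro h
      have := congrFun h p
      simp only [Function.update_of_ne hqp.symm] at this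
      omega
    · simp only [Function.update_self]; exact hvst
    · intro r hr; simp only [Function.update_of_ne hr]
    · rintro ⟨y, hy⟩ ⟨hyb, r, hr, hyr, hyt⟩
      simp only at *
      rcases hstep y hy r hr hyr hyt with rfl | ⟨rfl, -⟩
      · exfalso
        apply hyb
        funext t
        by_cases ht : t = r
        · subst ht
          have h1 := hy.1 t
          have h2 := hb.1 t
          rw [abs_le] at h1 h2
          rcases abs_cases (a t) with ⟨h3, h4⟩ | ⟨h3, h4⟩ <;> omega
        · rw [hyt t ht, hpq t ht]
      · apply Subtype.ext
        funext t
        by_cases ht : t = q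
        · subst ht
          simp only [Function.update_self]
          have h1 := hy.1 q
          rw [abs_le] at h1
          rw [hv]
          rcases abs_cases (a q) with ⟨h3, h4⟩ | ⟨h3, h4⟩ <;> split_ifs <;> omega
        · simp only [Function.update_of_ne ht]
          exact hyt t ht
  · have hlt : |a p| < 2 * N := lt_of_le_of_ne (ha.1 p) hap
    have hx : IsCell m N (Function.update b p (2 * a p - b p)) := by
      apply cell_of hb
      · intro r
        by_cases hr : r = p
        · subst hr
          rw [Function.update_self]
          rw [abs_lt] at hlt
          rw [abs_le]
          omega
        · rw [Function.update_of_ne hr]; exact hb.1 r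
      · intro r hr'
        by_cases hr : r = p
        · subst hr; exact absurd hr' (odd_ne hob)
        · rw [Function.update_of_ne hr]; exact hr'
    refine ⟨⟨_, hx⟩, ⟨?_, p, he, ?_, ?_⟩, ?_⟩
    · intro h
      have := congrFun h p
      simp only [Function.update_self] at this
      omega
    · simp only [Function.update_self]; omega
    · intro r hr; simp only [Function.update_of_ne hr]; exact hpq r hr
    · rintro ⟨y, hy⟩ ⟨hyb, r, hr, hyr, hyt⟩
      simp only at *
      rcases hstep y hy r hr hyr hyt with rfl | ⟨-, h⟩
      · apply Subtype.ext
        funext t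
        by_cases ht : t = r
        · subst ht
          simp only [Function.update_self]
          by_contra hcon
          apply hyb
          funext u
          by_cases hu : u = t
          · subst hu; omega
          · rw [hyt u hu, hpq u hu]
        · simp only [Function.update_of_ne ht]
          rw [hyt t ht, hpq t ht]
      · exact absurd h hap

end EP

namespace EP

/-- sign bit of the first nonzero entry of a block -/
def Neg {m : ℕ} (c : Raw m) (i : Fin 3) : Prop :=
  ∃ k, c (i, k) < 0 ∧ ∀ j < k, c (i, j) = 0

open Classical in
noncomputable def sA {m : ℕ} (c : Raw m) : Fin 3 → ZMod 2 := fun i => if Neg c i then 1 else 0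

def actR {m : ℕ} (g : Fin 3 → ZMod 2) (c : Raw m) : Raw m :=
  fun p => if g p.1 = 0 then c p else - c p

lemma neg_iff {m : ℕ} (c : Raw m) (i : Fin 3) (k : Fin (m + 1)) (hk : c (i, k) ≠ 0)
    (h : ∀ j < k, c (i, j) = 0) : Neg c i ↔ c (i, k) < 0 := by
  constructor
  · rintro ⟨k', h1, h2⟩
    rcases lt_trichotomy k k' with h3 | h3 | h3
    · exact absurd (h2 k h3) hk
    · rwa [h3]
    · rw [h k' h3] at h1; omega
  · intro h'; exact ⟨k, h', h⟩

lemma exists_first {m : ℕ} (c : Raw m) (i : Fin 3) (h : ∃ k, c (i, k) ≠ 0) :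
    ∃ k, c (i, k) ≠ 0 ∧ ∀ j < k, c (i, j) = 0 := by
  obtain ⟨k, hk, hmin⟩ := WellFounded.has_min (wellFounded_lt (α := Fin (m + 1)))
    {k | c (i, k) ≠ 0} h
  refine ⟨k, hk, fun j hj => ?_⟩
  by_contra hc
  exact hmin j hc hj

lemma sA_act {m : ℕ} (g : Fin 3 → ZMod 2) (c : Raw m) (h : ∀ i, ∃ k, c (i, k) ≠ 0) :
    sA (actR g c) = sA c + g := by
  funext i
  obtain ⟨k, hk, hk0⟩ := exists_first c i (h i)
  have h1 := neg_iff c i k hk hk0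
  have h2 := neg_iff (actR g c) i k (by unfold actR; split_ifs <;> simpa using hk)
    (by intro j hj; unfold actR; split_ifs <;> simp [hk0 j hj])
  have hg : g i = 0 ∨ g i = 1 := by
    generalize g i = x; revert x; decide
  simp only [sA, Pi.add_apply, h1, h2, actR]
  rcases hg with hg | hg
  · simp [hg]
  · simp only [hg, one_ne_zero, if_false, Left.neg_neg_iff]
    rcases lt_or_gt_of_ne hk with h3 | h3
    · rw [if_neg (by omega), if_pos h3]; rfl
    · rw [if_pos h3, if_neg (by omega)]; rfl

lemma cell_act {m N : ℕ} (g : Fin 3 → ZMod 2) {c : Raw m} (h : IsCell m N c) :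
    IsCell m N (actR g c) := by
  have : ∀ p, |actR g c p| = |c p| := by intro p; unfold actR; split_ifs <;> simp
  refine ⟨fun p => by rw [this]; exact h.1 p, fun i => ?_⟩
  obtain ⟨k, hk⟩ := h.2 i
  exact ⟨k, by rw [this]; exact hk⟩

lemma cell_ne {m N : ℕ} (hN : 1 ≤ N) {c : Raw m} (h : IsCell m N c) (i : Fin 3) :
    ∃ k, c (i, k) ≠ 0 := by
  obtain ⟨k, hk⟩ := h.2 i
  refine ⟨k, fun h0 => ?_⟩
  rw [h0] at hk; simp at hk; omega

lemma st_act {m : ℕ} (g : Fin 3 → ZMod 2) {c c' : Raw m} (h : St c c') :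
    St (actR g c) (actR g c') := by
  obtain ⟨p, he, hp, hq⟩ := h
  refine ⟨p, ?_, ?_, ?_⟩
  · unfold actR; split_ifs <;> simpa using he
  · unfold actR; split_ifs <;> omega
  · intro q hqp; unfold actR; rw [hq q hqp]

lemma isCh_update {V : Type*} (R : V → V → Prop) {n : ℕ} (σ : Fin (n + 2) → V) (h : IsCh R σ)
    (i : Fin (n + 2)) (x : V) : IsCh R (Function.update σ i x) ↔
      (∀ j : Fin (n + 1), j.succ = i → R (σ j.castSucc) x) ∧
      (∀ j : Fin (n + 1), j.castSucc = i → R x (σ j.succ)) := by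
  have hne : ∀ j : Fin (n + 1), j.castSucc ≠ j.succ := fun j => (Fin.castSucc_lt_succ).ne
  constructor
  · intro hu
    constructor
    · rintro j rfl
      have := hu j
      rwa [Function.update_self, Function.update_of_ne (hne j)] at this
    · rintro j rfl
      have := hu j
      rwa [Function.update_self, Function.update_of_ne (hne j).symm] at this
  · rintro ⟨h1, h2⟩ j
    by_cases e1 : j.succ = i
    · have := h1 j e1
      subst e1
      rwa [Function.update_self, Function.update_of_ne (hne j)]
    · rw [Function.update_of_ne e1]
      by_cases e2 : j.castSucc = i
      · have := h2 j e2
        subst e2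
        rwa [Function.update_self]
      · rw [Function.update_of_ne e2]; exact h j

lemma od_chain {m N n : ℕ} (hn : n + 1 = 3 * m) (σ : Fin (n + 2) → Cell m N)
    (h : IsCh (fun x y : Cell m N => St x.1 y.1) σ) :
    (∀ p, Even ((σ 0).1 p)) ∧ od (σ (Fin.last _)).1 = 3 * m := by
  have h1 : ∀ j : Fin (n + 2), od (σ j).1 = od (σ 0).1 + j := by
    intro j
    induction j using Fin.induction with
    | zero => simp
    | succ j ih =>
      rw [od_st (h j), ih]; simp; omega
  have h2 := h1 (Fin.last _)
  obtain ⟨K, -, h3, -⟩ := cell_even_card (σ (Fin.last _)).2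
  simp only [Fin.val_last] at h2
  refine ⟨?_, by omega⟩
  have h4 : od (σ 0).1 = 0 := by omega
  intro p
  unfold od at h4
  rw [Finset.card_eq_zero, Finset.filter_eq_empty_iff] at h4
  exact Int.not_odd_iff_even.1 (h4 (Finset.mem_univ p))

noncomputable def cellSys (m N n : ℕ) (hN : 1 ≤ N) (hn : n + 1 = 3 * m) : Sys (Cell m N) n where
  R := fun x y => St x.1 y.1
  act := fun g x => ⟨actR g x.1, cell_act g x.2⟩
  A := fun x => sA x.1
  act_act := by
    intro g x
    apply Subtype.ext
    funext p
    simp only [actR]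
    split_ifs <;> simp
  A_act := fun g x => sA_act g x.1 (cell_ne hN x.2)
  R_act := fun g x y h => st_act g h
  flip := by
    intro σ h i
    simp only [isCh_update _ σ h]
    obtain ⟨hev, hod⟩ := od_chain hn σ h
    have hsub : ∀ (x y : Cell m N), x ≠ y ↔ x.1 ≠ y.1 := by
      intro x y; rw [Ne, Ne, Subtype.ext_iff]
    simp only [hsub]
    rcases Fin.eq_castSucc_or_eq_last i with ⟨j, rfl⟩ | rfl
    · rcases Fin.eq_zero_or_eq_succ j with rfl | ⟨k, rfl⟩
      · obtain ⟨x, hx, hu⟩ := flip_bot (σ 0).2 (σ _).2 (h 0) hev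
        refine ⟨x, ⟨hx.1, ?_, ?_⟩, ?_⟩
        · intro j hj; exact absurd hj (by simp)
        · intro j hj
          have : j = 0 := Fin.castSucc_injective _ hj
          subst this; exact hx.2
        · rintro y ⟨h1, -, h2⟩
          exact hu y ⟨h1, h2 0 rfl⟩
      · obtain ⟨x, hx, hu⟩ := flip_mid (σ _).2 (σ _).2 (h k.castSucc) (h k.succ)
        refine ⟨x, ⟨hx.1, ?_, ?_⟩, ?_⟩
        · intro j hj
          have : j = k.castSucc := by
            rw [← Fin.succ_castSucc] at hj; exact Fin.succ_injective _ hj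
          subst this; exact hx.2.1
        · intro j hj
          have : j = k.succ := Fin.castSucc_injective _ hj
          subst this; exact hx.2.2
        · rintro y ⟨h1, h2, h3⟩
          exact hu y ⟨h1, h2 k.castSucc (Fin.succ_castSucc k), h3 k.succ rfl⟩
    · obtain ⟨x, hx, hu⟩ := flip_top hN (σ _).2 (σ _).2 (h (Fin.last n)) (by rwa [Fin.succ_last])
      refine ⟨x, ⟨hx.1, ?_, ?_⟩, ?_⟩
      · intro j hj
        have : j = Fin.last n := by
          rw [← Fin.succ_last] at hj; exact Fin.succ_injective _ hj
        subst this; exact hx.2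
      · intro j hj; exact absurd hj (Fin.castSucc_lt_last j).ne
      · rintro y ⟨h1, h2, -⟩
        exact hu y ⟨h1, h2 _ (Fin.succ_last _)⟩

end EP

namespace EP

/-! ### Evaluation of the top class -/

lemma zmod2_ne {x y : ZMod 2} (h : x ≠ y) : x + y = 1 := by
  revert x y; decide

lemma zmod2_ne_zero {x y : ZMod 2} (h : x + y ≠ 0) : x ≠ y := by
  revert x y; decide

lemma zmod2_one {x : ZMod 2} (h : x ≠ 0) : x = 1 := by
  revert x; decide

/-- the explicit chain -/
def ex (m N : ℕ) (j : ℕ) : Raw m := fun p =>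
  if (p.2 : ℕ) = m then 2 * N
  else if j < m * p.1 + (m - p.2) then 0 else (-1) ^ (m - p.2 : ℕ)

lemma sA_of_nonneg {m : ℕ} (c : Raw m) (i : Fin 3) (k : Fin (m + 1)) (hk : 0 < c (i, k))
    (h : ∀ j < k, c (i, j) = 0) : sA c i = 0 := by
  unfold sA
  rw [if_neg]
  rw [neg_iff c i k hk.ne' h]; omega

lemma sA_of_neg {m : ℕ} (c : Raw m) (i : Fin 3) (k : Fin (m + 1)) (hk : c (i, k) < 0)
    (h : ∀ j < k, c (i, j) = 0) : sA c i = 1 := by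
  unfold sA
  rw [if_pos]
  rw [neg_iff c i k hk.ne h]; omega

lemma sA_congr {m : ℕ} (c c' : Raw m) (i : Fin 3) (k : Fin (m + 1)) (hk : c (i, k) ≠ 0)
    (hk' : c' (i, k) ≠ 0) (hs : c (i, k) < 0 ↔ c' (i, k) < 0)
    (h : ∀ j < k, c (i, j) = 0) (h' : ∀ j < k, c' (i, j) = 0) : sA c i = sA c' i := by
  unfold sA
  simp only [neg_iff c i k hk h, neg_iff c' i k hk' h', hs]

lemma ex_unique {m N : ℕ} (hN : 1 ≤ N) (hm : 1 ≤ m) (s : ℕ → Raw m)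
    (h0 : ∀ p, Even (s 0 p)) (htop : ∀ p, Even (s (3 * m) p) → |s (3 * m) p| = 2 * N)
    (hst : ∀ j < 3 * m, St (s j) (s (j + 1)))
    (halt : ∀ i : Fin 3, ∀ t < m, sA (s (m * i + t)) i ≠ sA (s (m * i + t + 1)) i)
    (hA : ∀ i, sA (s 0) i = 0) : ∀ j ≤ 3 * m, s j = ex m N j := by
  have hp' : ∀ j, ∃ p, j < 3 * m → (Even (s j p) ∧ (s (j+1) p = s j p + 1 ∨ s (j+1) p = s j p - 1) ∧
      ∀ q, q ≠ p → s (j+1) q = s j q) := by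
    intro j
    by_cases h : j < 3 * m
    · obtain ⟨p, hp⟩ := hst j h; exact ⟨p, fun _ => hp⟩
    · exact ⟨default, fun h' => absurd h' h⟩
  choose p hp using hp'
  -- F1
  have F1 : ∀ j r, Odd (s j r) → ∀ j', j ≤ j' → j' ≤ 3 * m → s j' r = s j r := by
    intro j r ho j' hjj
    induction j', hjj using Nat.le_induction with
    | base => intro _; rfl
    | succ j' hj ih =>
      intro hle
      have e := ih (by omega)
      obtain ⟨a1, a2, a3⟩ := hp j' (by omega)
      by_cases hr : r = p j'
      · subst hr
        rw [← e] at ho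
        exact absurd ho (Int.not_odd_iff_even.2 a1)
      · rw [a3 r hr, e]
  have F1' : ∀ j r, Even (s j r) → ∀ j', j' ≤ j → j ≤ 3 * m → Even (s j' r) := by
    intro j r he j' h1 h2
    by_contra hc
    rw [Int.not_even_iff_odd] at hc
    have := F1 j' r hc j h1 h2
    rw [← this] at hc
    exact absurd he (Int.not_even_iff_odd.2 hc)
  have F2 : ∀ j r, Even (s j r) → j ≤ 3 * m → s j r = s 0 r := by
    intro j r
    induction j with
    | zero => intro _ _; rfl
    | succ j ih =>
      intro he hle
      have e1 := F1' (j + 1) r he j (by omega) hle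
      rw [← ih e1 (by omega)]
      obtain ⟨a1, a2, a3⟩ := hp j (by omega)
      by_cases hr : r = p j
      · subst hr
        have := odd_of_st a1 a2
        exact absurd he (Int.not_even_iff_odd.2 this)
      · exact a3 r hr
  have F3 : ∀ j < 3 * m, Odd (s (j + 1) (p j)) := by
    intro j hj
    obtain ⟨a1, a2, a3⟩ := hp j hj
    exact odd_of_st a1 a2
  have F4 : ∀ r, Odd (s (3 * m) r) → ∃ j < 3 * m, p j = r := by
    intro r ho
    by_contra! hc
    have : ∀ j ≤ 3 * m, s j r = s 0 r := by
      intro j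
      induction j with
      | zero => intro _; rfl
      | succ j ih =>
        intro hle
        obtain ⟨a1, a2, a3⟩ := hp j (by omega)
        rw [a3 r (hc j (by omega)).symm, ih (by omega)]
    rw [this _ le_rfl] at ho
    exact absurd (h0 r) (Int.not_even_iff_odd.2 ho)
  have hi3 : ∀ i : Fin 3, m * (i : ℕ) + m ≤ 3 * m := by
    intro i
    have := i.2
    have : (i : ℕ) + 1 ≤ 3 := by omega
    nlinarith
  -- block of a step
  have F5 : ∀ i : Fin 3, ∀ t < m, (p (m * i + t)).1 = i := by
    intro i t ht
    by_contra hc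
    have hlt : m * (i : ℕ) + t < 3 * m := by have := hi3 i; omega
    obtain ⟨a1, a2, a3⟩ := hp _ hlt
    apply halt i t ht
    have : ∀ k, s (m * i + t + 1) (i, k) = s (m * i + t) (i, k) := by
      intro k
      apply a3
      intro h; apply hc; rw [← h]
    have hiff : Neg (s (m * i + t + 1)) i ↔ Neg (s (m * i + t)) i := by
      simp only [Neg, this]
    simp only [sA]
    classical exact if_congr hiff.symm rfl rfl
  have F6 : ∀ j < 3 * m, ∀ i : Fin 3, (p j).1 = i → ∃ t < m, j = m * i + t := by
    intro j hj i hi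
    have hd : j / m < 3 := by rw [Nat.div_lt_iff_lt_mul (by omega)]; omega
    have := F5 ⟨j / m, hd⟩ (j % m) (Nat.mod_lt _ (by omega))
    simp only [Nat.div_add_mod] at this
    rw [hi] at this
    subst this
    exact ⟨j % m, Nat.mod_lt _ (by omega), (Nat.div_add_mod j m).symm⟩
  -- main induction
  have Q : ∀ i : Fin 3, ∀ k : ℕ, ∀ hk : k < m, s 0 (i, ⟨k, by omega⟩) = 0 ∧
      p (m * i + (m - k - 1)) = (i, ⟨k, by omega⟩) := by
    intro i k
    induction k using Nat.strong_induction_on with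
    | _ k ih =>
    intro hk
    have hi := hi3 i
    have hz : ∀ j ≤ m * i + (m - k), ∀ k' : Fin (m + 1), (k' : ℕ) < k → s j (i, k') = 0 := by
      intro j hj k' hk'
      obtain ⟨b1, b2⟩ := ih k' hk' (by omega)
      have hlt : m * (i : ℕ) + (m - k' - 1) < 3 * m := by omega
      obtain ⟨a1, -, -⟩ := hp _ hlt
      rw [b2] at a1
      have := F1' _ _ a1 j (by omega) (by omega)
      rw [F2 j _ this (by omega)]
      exact b1
    have hs0 : s 0 (i, ⟨k, by omega⟩) = 0 := by
      by_contra hne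
      have hev := h0 (i, ⟨k, by omega⟩)
      have key : ∀ j ≤ 3 * m, s j (i, ⟨k, by omega⟩) ≠ 0 ∧
          (s j (i, ⟨k, by omega⟩) < 0 ↔ s 0 (i, ⟨k, by omega⟩) < 0) := by
        intro j
        induction j with
        | zero => intro _; exact ⟨hne, Iff.rfl⟩
        | succ j ihj =>
          intro hle
          obtain ⟨c1, c2⟩ := ihj (by omega)
          obtain ⟨a1, a2, a3⟩ := hp j (by omega)
          by_cases hr : (i, ⟨k, by omega⟩) = p j
          · rw [← hr] at a1 a2
            obtain ⟨z, hz⟩ := a1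
            omega
          · rw [a3 _ hr]; exact ⟨c1, c2⟩
      apply halt i 0 (by omega)
      obtain ⟨c1, c2⟩ := key (m * i + 0) (by omega)
      obtain ⟨d1, d2⟩ := key (m * i + 0 + 1) (by omega)
      exact sA_congr _ _ i _ c1 d1 (c2.trans d2.symm) (fun j hj => hz _ (by omega) j hj)
        (fun j hj => hz _ (by omega) j hj)
    refine ⟨hs0, ?_⟩
    have hodd : Odd (s (3 * m) (i, ⟨k, by omega⟩)) := by
      by_contra hc
      rw [Int.not_odd_iff_even] at hc
      have h1 := htop _ hc
      rw [F2 _ _ hc le_rfl, hs0] at h1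
      simp at h1; omega
    obtain ⟨j, hj, hpj⟩ := F4 _ hodd
    obtain ⟨t, ht, rfl⟩ := F6 j hj i (by rw [hpj])
    have ho := F3 _ hj
    rw [hpj] at ho
    rcases lt_trichotomy t (m - k - 1) with h | h | h
    · exfalso
      apply halt i (t + 1) (by omega)
      have e1 := F1 _ _ ho (m * i + (t + 1) + 1) (by omega) (by omega)
      have hne : s (m * i + t + 1) (i, ⟨k, by omega⟩) ≠ 0 := by
        intro h; rw [h] at ho; simp at ho
      refine sA_congr _ _ i ⟨k, by omega⟩ hne (by rwa [e1]) (by rw [e1]; rfl)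
        (fun j hj => hz _ (by omega) j hj) (fun j hj => hz _ (by omega) j hj)
    · rw [← h]; exact hpj
    · exfalso
      obtain ⟨b1, b2⟩ := ih (m - 1 - t) (by omega) (by omega)
      have : m - (m - 1 - t) - 1 = t := by omega
      rw [this, hpj] at b2
      have := congrArg (fun r : Fin 3 × Fin (m + 1) => (r.2 : ℕ)) b2
      simp at this
      omega
  -- last coordinate
  have hlast : ∀ i : Fin 3, ∀ j ≤ 3 * m, s j (i, Fin.last m) = 2 * N := by
    intro i
    have hev : Even (s (3 * m) (i, Fin.last m)) := by
      by_contra hc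
      rw [Int.not_even_iff_odd] at hc
      obtain ⟨j, hj, hpj⟩ := F4 _ hc
      obtain ⟨t, ht, rfl⟩ := F6 j hj i (by rw [hpj])
      obtain ⟨b1, b2⟩ := Q i (m - 1 - t) (by omega)
      have : m - (m - 1 - t) - 1 = t := by omega
      rw [this, hpj] at b2
      have := congrArg (fun r : Fin 3 × Fin (m + 1) => (r.2 : ℕ)) b2
      simp at this
      omega
    have habs := htop _ hev
    rw [F2 _ _ hev le_rfl] at habs
    have hz0 : ∀ k < Fin.last m, s 0 (i, k) = 0 := by
      intro k hk
      exact (Q i k (by simpa [Fin.lt_def] using hk)).1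
    have h20 : s 0 (i, Fin.last m) = 2 * N := by
      rcases abs_cases (s 0 (i, Fin.last m)) with ⟨c1, c2⟩ | ⟨c1, c2⟩
      · omega
      · exfalso
        have := sA_of_neg (s 0) i (Fin.last m) c2 hz0
        rw [hA i] at this
        exact absurd this (by decide)
    intro j hj
    rw [F2 j _ (F1' _ _ hev j hj le_rfl) hj, h20]
  have hzero : ∀ i : Fin 3, ∀ k : Fin (m + 1), (k : ℕ) < m → ∀ j < m * (i : ℕ) + (m - k), s j (i, k) = 0 := by
    intro i k hk j hj
    have hi := hi3 i
    obtain ⟨b1, b2⟩ := Q i k hk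
    have hlt : m * (i : ℕ) + (m - k - 1) < 3 * m := by omega
    obtain ⟨a1, -, -⟩ := hp _ hlt
    rw [b2] at a1
    have := F1' _ _ a1 j (by omega) (by omega)
    rw [F2 j _ this (by omega)]
    exact b1
  have hsign : ∀ i : Fin 3, ∀ t ≤ m, sA (s (m * i + t)) i = (t : ZMod 2) := by
    intro i t
    induction t with
    | zero =>
      intro _
      have hi := hi3 i
      rw [sA_of_nonneg (s (m * i + 0)) i (Fin.last m)]
      · simp
      · rw [hlast i _ (by omega)]; omega
      · intro k hk
        have : (k : ℕ) < m := by simpa [Fin.lt_def] using hk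
        exact hzero i k this _ (by omega)
    | succ t ih =>
      intro ht
      have h1 := halt i t (by omega)
      rw [ih (by omega)] at h1
      have h2 := zmod2_ne h1
      push_cast
      rw [← add_assoc]
      linear_combination h2 - two_eq_zero' (t : ZMod 2)
  intro j hj
  funext r
  obtain ⟨i, k⟩ := r
  have hi := hi3 i
  unfold ex
  simp only
  split_ifs with h1 h2
  · have : k = Fin.last m := Fin.ext (by simpa using h1)
    rw [this]; exact hlast i j hj
  · exact hzero i k (by omega) j h2
  · have hk : (k : ℕ) < m := by omega
    obtain ⟨b1, b2⟩ := Q i k hk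
    have hlt : m * (i : ℕ) + (m - k - 1) < 3 * m := by omega
    have ho := F3 _ hlt
    obtain ⟨a1, a2, a3⟩ := hp _ hlt
    have e : m * (i : ℕ) + (m - k - 1) + 1 = m * i + (m - k) := by omega
    rw [b2] at ho a2
    rw [hzero i ⟨k, by omega⟩ hk (m * (i : ℕ) + (m - k - 1)) (by simp only; omega), e] at a2
    rw [e] at ho
    have e1 := F1 _ _ ho j (by omega) hj
    have hs := hsign i (m - k) (by omega)
    have hz : ∀ k' < k, s (m * i + (m - k)) (i, k') = 0 := by
      intro k' hk'
      have : (k' : ℕ) < k := hk'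
      exact hzero i k' (by omega) _ (by omega)
    rw [show (i, k) = (i, (⟨k, by omega⟩ : Fin (m + 1))) from rfl, e1]
    rcases a2 with a2 | a2
    · have := sA_of_nonneg _ i k (by
        change 0 < s (m * i + (m - k)) (i, ⟨k, by omega⟩)
        rw [a2]; norm_num) hz
      rw [this] at hs
      have hev : Even (m - (k : ℕ)) := by
        rw [← ZMod.natCast_eq_zero_iff_even]; exact hs.symm
      rw [a2, hev.neg_one_pow]; rfl
    · have := sA_of_neg _ i k (by
        change s (m * i + (m - k)) (i, ⟨k, by omega⟩) < 0
        rw [a2]; norm_num) hz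
      rw [this] at hs
      have hev : Odd (m - (k : ℕ)) := by
        rw [← ZMod.natCast_eq_one_iff_odd]; exact hs.symm
      rw [a2, hev.neg_one_pow]; rfl

lemma ex_cell {m N : ℕ} (hN : 1 ≤ N) (j : ℕ) : IsCell m N (ex m N j) := by
  refine ⟨fun p => ?_, fun i => ⟨Fin.last m, ?_⟩⟩
  · unfold ex
    split_ifs
    · simp
    · simp
    · rw [abs_pow]; simp; omega
  · simp [ex]

lemma ex_st {m N : ℕ} (i : Fin 3) (t : ℕ) (ht : t < m) :
    St (ex m N (m * i + t)) (ex m N (m * i + t + 1)) := by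
  refine ⟨(i, ⟨m - 1 - t, by omega⟩), ?_, ?_, ?_⟩
  · unfold ex
    simp only
    rw [if_neg (by omega), if_pos (by omega)]
    simp
  · have e1 : ex m N (m * i + t) (i, ⟨m - 1 - t, by omega⟩) = 0 := by
      unfold ex
      simp only
      rw [if_neg (by omega), if_pos (by omega)]
    have e2 : ex m N (m * i + t + 1) (i, ⟨m - 1 - t, by omega⟩) = (-1) ^ (m - (m - 1 - t)) := by
      unfold ex
      simp only
      rw [if_neg (by omega), if_neg (by omega)]
    rw [e1, e2]
    rcases neg_one_pow_eq_or ℤ (m - (m - 1 - t)) with h | h <;> rw [h] <;> simp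
  · rintro ⟨i', k⟩ hne
    unfold ex
    simp only
    by_cases hk : (k : ℕ) = m
    · simp [hk]
    · rw [if_neg hk, if_neg hk]
      have hiff : m * (i : ℕ) + t + 1 < m * i' + (m - k) ↔ m * (i : ℕ) + t < m * i' + (m - k) := by
        have hk2 := k.2
        rcases lt_trichotomy i i' with h | h | h
        · have : (i : ℕ) + 1 ≤ i' := h
          have := Nat.mul_le_mul_left m this
          rw [mul_add] at this
          omega
        · subst h
          have : (k : ℕ) ≠ m - 1 - t := by
            intro h; apply hne; exact Prod.ext rfl (Fin.ext h)
          omega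
        · have : (i' : ℕ) + 1 ≤ i := h
          have := Nat.mul_le_mul_left m this
          rw [mul_add] at this
          omega
      simp only [hiff]

lemma ex_sA {m N : ℕ} (hN : 1 ≤ N) (i : Fin 3) (t : ℕ) (ht : t ≤ m) :
    sA (ex m N (m * i + t)) i = (t : ZMod 2) := by
  have hz : ∀ k : Fin (m + 1), (k : ℕ) < m - t → ex m N (m * i + t) (i, k) = 0 := by
    intro k hk
    unfold ex
    simp only
    rw [if_neg (by omega), if_pos (by omega)]
  rcases Nat.eq_zero_or_pos t with h | h
  · subst h
    rw [sA_of_nonneg _ i (Fin.last m)]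
    · simp
    · simp [ex]; omega
    · intro k hk; exact hz k (by simpa [Fin.lt_def] using hk)
  · have hv : ex m N (m * i + t) (i, ⟨m - t, by omega⟩) = (-1) ^ t := by
      unfold ex
      simp only
      rw [if_neg (by omega), if_neg (by omega)]
      congr 1; omega
    rcases Nat.even_or_odd t with h' | h'
    · rw [sA_of_nonneg _ i ⟨m - t, by omega⟩]
      · exact ((ZMod.natCast_eq_zero_iff_even).2 h').symm
      · rw [hv, h'.neg_one_pow]; norm_num
      · intro k hk; exact hz k hk
    · rw [sA_of_neg _ i ⟨m - t, by omega⟩]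
      · exact ((ZMod.natCast_eq_one_iff_odd).2 h').symm
      · rw [hv, h'.neg_one_pow]; norm_num
      · intro k hk; exact hz k hk

lemma ex_sA0 {m N : ℕ} (hN : 1 ≤ N) (i : Fin 3) : sA (ex m N 0) i = 0 := by
  rw [sA_of_nonneg _ i (Fin.last m)]
  · simp [ex]; omega
  · intro k hk
    have hk' : (k : ℕ) < m := by simpa [Fin.lt_def] using hk
    unfold ex
    simp only
    rw [if_neg (by omega), if_pos (by omega)]

/-- block odd count -/
def odb {m : ℕ} (i : Fin 3) (c : Raw m) : ℕ := (Finset.univ.filter (fun k => Odd (c (i, k)))).card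

lemma odb_le {m N : ℕ} {c : Raw m} (h : IsCell m N c) (i : Fin 3) : odb i c ≤ m := by
  obtain ⟨k, hk⟩ := h.2 i
  have : Finset.univ.filter (fun k => Odd (c (i, k))) ⊂ Finset.univ := by
    rw [Finset.ssubset_univ_iff]
    intro h'
    have : k ∈ Finset.univ.filter (fun k => Odd (c (i, k))) := by rw [h']; simp
    exact odd_ne (by simpa using this) hk
  have := Finset.card_lt_card this
  unfold odb
  simp at this; omega

lemma odb_st {m : ℕ} {c c' : Raw m} (h : St c c') (i : Fin 3) (hA : sA c i + sA c' i ≠ 0)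
    (i' : Fin 3) : odb i' c' = odb i' c + if i = i' then 1 else 0 := by
  obtain ⟨p, he, hp, hq⟩ := h
  have hpi : p.1 = i := by
    by_contra hc
    apply zmod2_ne_zero hA
    have : ∀ k, c' (i, k) = c (i, k) := by
      intro k
      apply hq
      intro h; apply hc; rw [← h]
    have hiff : Neg c' i ↔ Neg c i := by simp only [Neg, this]
    simp only [sA]
    classical exact if_congr hiff.symm rfl rfl
  subst hpi
  have hp' := odd_of_st he hp
  unfold odb
  split_ifs with h
  · subst h
    have : Finset.univ.filter (fun k => Odd (c' (p.1, k))) =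
        insert p.2 (Finset.univ.filter (fun k => Odd (c (p.1, k)))) := by
      ext k
      simp only [Finset.mem_filter, Finset.mem_univ, true_and, Finset.mem_insert]
      by_cases h : k = p.2
      · subst h; simp [hp']
      · have : (p.1, k) ≠ p := by intro h'; apply h; rw [← h']
        simp [h, hq _ this]
    rw [this, Finset.card_insert_of_notMem]
    simpa using he
  · rw [add_zero]
    congr 1
    ext k
    have : (i', k) ≠ p := by intro h'; apply h; rw [← h']
    simp [hq _ this]

lemma W_ne_zero {V : Type*} (l : List (V → V → ZMod 2)) (U : (ℕ → V) → ZMod 2) (s : ℕ → V)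
    (h : W l U s ≠ 0) (j : ℕ) (hj : j < l.length) : l[j] (s j) (s (j + 1)) ≠ 0 := by
  induction l generalizing s j with
  | nil => simp at hj
  | cons e l ih =>
    simp only [W] at h
    cases j with
    | zero => exact left_ne_zero_of_mul h
    | succ j =>
      have := ih (fun k => s (k + 1)) (right_ne_zero_of_mul h) j (by simpa using hj)
      simpa using this

lemma W_one {V : Type*} (l : List (V → V → ZMod 2)) (s : ℕ → V)
    (h : ∀ j (hj : j < l.length), l[j] (s j) (s (j + 1)) = 1) : W l (fun _ => 1) s = 1 := by
  induction l generalizing s with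
  | nil => rfl
  | cons e l ih =>
    simp only [W]
    rw [ih]
    · have := h 0 (by simp)
      simpa using this
    · intro j hj
      have := h (j + 1) (by simpa using hj)
      simpa using this

end EP

namespace EP

lemma odb_chain {m : ℕ} (i' : Fin 3) (l : List (Fin 3)) (s : ℕ → Raw m)
    (h : ∀ j (hj : j < l.length), St (s j) (s (j + 1)) ∧ sA (s j) l[j] + sA (s (j + 1)) l[j] ≠ 0) :
    odb i' (s l.length) = odb i' (s 0) + l.count i' := by
  induction l generalizing s with
  | nil => simp
  | cons a l ih =>
    have h0 := h 0 (by simp)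
    have h1 := ih (fun k => s (k + 1)) (fun j hj => by
      have := h (j + 1) (by simpa using hj)
      simpa using this)
    have h2 := odb_st h0.1 a h0.2 i'
    simp only [List.length_cons, List.count_cons, zero_add] at h1 h2 ⊢
    rw [h1, h2]
    by_cases h : a = i' <;> simp [h]
    omega

lemma sq_lt {V : Type*} {n : ℕ} (σ : Fin (n + 2) → V) (k : ℕ) (hk : k < n + 2) :
    sq σ k = σ ⟨k, hk⟩ := by
  unfold sq
  congr 1
  exact Fin.ext (Nat.mod_eq_of_lt hk)

section
variable {m N n : ℕ} (hN : 1 ≤ N) (hn : n + 1 = 3 * m)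

lemma chain_st (σ : Fin (n + 2) → Cell m N) (h : IsCh (cellSys m N n hN hn).R σ) (j : ℕ)
    (hj : j < n + 1) : St (sq σ j).1 (sq σ (j + 1)).1 := by
  have := h ⟨j, hj⟩
  rw [sq_lt σ j (by omega), sq_lt σ (j + 1) (by omega)]
  exact this

lemma chain_nz (l : List (Fin 3)) (σ : Fin (n + 2) → Cell m N)
    (hW : W (l.map (al (cellSys m N n hN hn))) (fun _ => 1) (sq σ) ≠ 0)
    (j : ℕ) (hj : j < l.length) :
    sA (sq σ j).1 l[j] + sA (sq σ (j + 1)).1 l[j] ≠ 0 := by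
  have := W_ne_zero _ _ _ hW j (by simpa using hj)
  rw [List.getElem_map] at this
  exact this

lemma chain_count (l : List (Fin 3)) (hl : l.length = n + 1) (σ : Fin (n + 2) → Cell m N)
    (h : IsCh (cellSys m N n hN hn).R σ)
    (hW : W (l.map (al (cellSys m N n hN hn))) (fun _ => 1) (sq σ) ≠ 0) (i : Fin 3) :
    l.count i ≤ m := by
  have := odb_chain i l (fun k => (sq σ k).1) (fun j hj =>
    ⟨chain_st hN hn σ h j (by omega), chain_nz hN hn l σ hW j hj⟩)
  have h2 := odb_le (sq σ l.length).2 i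
  omega

lemma count_sum (l : List (Fin 3)) : l.count 0 + l.count 1 + l.count 2 = l.length := by
  induction l with
  | nil => rfl
  | cons a l ih =>
    simp only [List.count_cons, List.length_cons]
    fin_cases a <;> simp <;> omega

lemma T_rep (hm : 1 ≤ m) : T (cellSys m N n hN hn)
    ((List.replicate m 0 ++ List.replicate m 1 ++ List.replicate m 2 : List (Fin 3)).map
      (al (cellSys m N n hN hn))) = 1 := by
  classical
  set S := cellSys m N n hN hn with hS
  set l : List (Fin 3) := List.replicate m 0 ++ List.replicate m 1 ++ List.replicate m 2 with hl
  have hlen : l.length = n + 1 := by simp [hl]; omega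
  have hget : ∀ i : Fin 3, ∀ t < m, ∀ h : m * i + t < l.length, l[m * i + t] = i := by
    intro i t ht h
    fin_cases i
    · simp [hl, List.getElem_append, ht, show t < m + m by omega]
    · simp [hl, List.getElem_append, ht]
    · simp [hl, List.getElem_append]
      rw [if_neg (by omega), if_neg (by omega)]
  let σ₀ : Fin (n + 2) → Cell m N := fun j => ⟨ex m N j, ex_cell hN j⟩
  have hdec : ∀ j < n + 1, ∃ i : Fin 3, ∃ t < m, j = m * i + t := by
    intro j hj
    refine ⟨⟨j / m, ?_⟩, j % m, Nat.mod_lt _ (by omega), (Nat.div_add_mod j m).symm⟩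
    rw [Nat.div_lt_iff_lt_mul (by omega)]; omega
  have hσ : IsCh S.R σ₀ := by
    intro j
    obtain ⟨i, t, ht, h⟩ := hdec j j.2
    change St (ex m N (j : ℕ)) (ex m N ((j : ℕ) + 1))
    rw [h]
    exact ex_st i t ht
  rw [T, tot, Finset.sum_eq_single σ₀]
  · have h1 : ind S (σ₀ 0) = 1 := by
      unfold ind
      rw [if_pos]
      funext i
      exact ex_sA0 hN i
    rw [h1, one_mul, W_one]
    intro j hj
    have hj' : j < l.length := by simpa using hj
    obtain ⟨i, t, ht, h⟩ := hdec j (by omega)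
    subst h
    simp only [List.getElem_map]
    rw [hget i t ht hj', sq_lt σ₀ _ (by omega), sq_lt σ₀ _ (by omega)]
    change sA (ex m N (m * i + t)) i + sA (ex m N (m * i + (t + 1))) i = 1
    rw [ex_sA hN i t (by omega), ex_sA hN i (t + 1) (by omega)]
    push_cast
    linear_combination two_eq_zero' (t : ZMod 2)
  · intro σ hσ' hne
    have hch : IsCh S.R σ := by simpa using hσ'
    by_contra hc
    have hind := left_ne_zero_of_mul hc
    have hW := right_ne_zero_of_mul hc
    apply hne
    obtain ⟨hev, hod⟩ := od_chain hn σ hch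
    have := ex_unique hN hm (fun k => (sq σ k).1) (by
        intro p
        have := hev p
        rw [sq_lt σ 0 (by omega)]; exact this) (by
        intro p
        have e : sq σ (3 * m) = σ (Fin.last _) := by
          rw [sq_lt σ _ (by omega)]; congr 1; exact Fin.ext (by simp; omega)
        simp only [e]
        intro he
        obtain ⟨K, h1, -, h3⟩ := cell_even_card (σ (Fin.last _)).2
        have := h3 hod p he
        rw [← h1 p.1, ← this]) (fun j hj => chain_st hN hn σ hch j (by omega)) (by
        intro i t ht
        have hlt : m * (i : ℕ) + t < l.length := by
          rw [hlen, hn]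
          have := i.2
          have : (i : ℕ) + 1 ≤ 3 := by omega
          nlinarith
        have := chain_nz hN hn l σ hW _ hlt
        rw [hget i t ht hlt] at this
        exact zmod2_ne_zero this) (by
        intro i
        unfold ind at hind
        have : S.A (σ 0) = 0 := by
          by_contra h; rw [if_neg h] at hind; exact hind rfl
        have := congrFun this i
        rw [sq_lt σ 0 (by omega)]; exact this)
    funext j
    apply Subtype.ext
    have h := this j (by have := j.2; omega)
    rw [sq_lt σ _ j.2] at h
    exact h
  · intro h
    exact absurd (by simpa using hσ) h

lemma h0_cell (hm : 1 ≤ m) (l : List (Fin 3)) (hlen : l.length = n + 1) :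
    T (cellSys m N n hN hn) (l.map (al (cellSys m N n hN hn))) =
      MvPolynomial.coeff (Finsupp.equivFunOnFinite.symm (fun _ => m))
        ((l.map (fun i => (MvPolynomial.X i : MvPolynomial (Fin 3) (ZMod 2)))).prod) := by
  classical
  have hmon : ∀ l : List (Fin 3), (l.map (fun i => (MvPolynomial.X i : MvPolynomial (Fin 3) (ZMod 2)))).prod
      = MvPolynomial.monomial (Finsupp.equivFunOnFinite.symm (fun i => l.count i)) 1 := by
    intro l
    induction l with
    | nil =>
      simp only [List.map_nil, List.prod_nil, List.count_nil]
      rw [MvPolynomial.one_def]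
      congr 2
      ext i
      simp
    | cons a l ih =>
      rw [List.map_cons, List.prod_cons, ih, MvPolynomial.X, MvPolynomial.monomial_mul, one_mul]
      congr 2
      ext i
      simp [List.count_cons, Finsupp.single_apply, add_comm]
  rw [hmon, MvPolynomial.coeff_monomial]
  split_ifs with h
  · have hc : ∀ i, l.count i = m := by
      intro i
      have := DFunLike.congr_fun h i
      simpa using this
    have hp : l.Perm (List.replicate m 0 ++ List.replicate m 1 ++ List.replicate m 2) := by
      rw [List.perm_iff_count]
      intro a
      rw [hc a]
      fin_cases a <;> simp [List.count_replicate]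
    have := T_perm (cellSys m N n hN hn) _ _ (hp.map (al (cellSys m N n hN hn))) [] (by
      intro e he
      simp only [List.nil_append, List.mem_map] at he
      obtain ⟨i, -, rfl⟩ := he
      exact good_al _ i) (by simpa using hlen)
    simp only [List.nil_append] at this
    rw [this, T_rep hN hn hm]
  · rw [T, tot]
    refine Finset.sum_eq_zero fun σ hσ => ?_
    have hch : IsCh (cellSys m N n hN hn).R σ := by simpa using hσ
    by_contra hc
    have hW := right_ne_zero_of_mul hc
    apply h
    have := fun i => chain_count hN hn l hlen σ hch hW i
    have h0 := this 0
    have h1 := this 1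
    have h2 := this 2
    have h3 := count_sum l
    ext i
    simp only [Finsupp.equivFunOnFinite_symm_apply_apply]
    fin_cases i <;> simp <;> omega

end
end EP

namespace EP

/-! ### The Borsuk-Ulam type theorem on a product of three spheres -/

/-- product of three sup-norm spheres -/
def Sph (m : ℕ) : Set (Fin 3 × Fin (m + 1) → ℝ) :=
  {x | (∀ p, |x p| ≤ 1) ∧ ∀ i, ∃ k, |x (i, k)| = 1}

def actP {m : ℕ} (g : Fin 3 → ZMod 2) (x : Fin 3 × Fin (m + 1) → ℝ) : Fin 3 × Fin (m + 1) → ℝ :=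
  fun p => if g p.1 = 0 then x p else - x p

lemma sph_compact (m : ℕ) : IsCompact (Sph m) := by
  have h1 : IsCompact {x : Fin 3 × Fin (m + 1) → ℝ | ∀ p, x p ∈ Set.Icc (-1 : ℝ) 1} :=
    isCompact_pi_infinite (fun _ => isCompact_Icc)
  have h2 : IsClosed {x : Fin 3 × Fin (m + 1) → ℝ | ∀ i, ∃ k, |x (i, k)| = 1} := by
    simp only [Set.ofPred_forall, Set.ofPred_exists]
    refine isClosed_iInter fun i => isClosed_iUnion_of_finite fun k => ?_
    exact isClosed_eq (by fun_prop) (by fun_prop)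
  have := h1.inter_right h2
  convert this using 1
  ext x
  simp [Sph, abs_le]

noncomputable def pt {m N : ℕ} (c : Cell m N) : Fin 3 × Fin (m + 1) → ℝ :=
  fun p => (c.1 p : ℝ) / (2 * N)

lemma pt_mem {m N : ℕ} (hN : 1 ≤ N) (c : Cell m N) : pt c ∈ Sph m := by
  have hN' : (0 : ℝ) < 2 * N := by positivity
  have habs : ∀ p, |pt c p| = ((|c.1 p| : ℤ) : ℝ) / (2 * N) := by
    intro p
    unfold pt
    rw [abs_div, abs_of_pos hN', Int.cast_abs]
  refine ⟨fun p => ?_, fun i => ?_⟩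
  · rw [habs, div_le_one hN']
    exact_mod_cast c.2.1 p
  · obtain ⟨k, hk⟩ := c.2.2 i
    refine ⟨k, ?_⟩
    rw [habs, hk]
    push_cast
    exact div_self hN'.ne'

lemma chain_near {m N n : ℕ} (hN : 1 ≤ N) (hn : n + 1 = 3 * m) (σ : Fin (n + 2) → Cell m N)
    (h : IsCh (cellSys m N n hN hn).R σ) (k : ℕ) (hk : k < n + 2) (p) :
    |(sq σ k).1 p - (sq σ 0).1 p| ≤ 1 := by
  have hev := (od_chain hn σ h).1
  have key : (Even ((sq σ k).1 p) ∧ (sq σ k).1 p = (sq σ 0).1 p) ∨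
      (Odd ((sq σ k).1 p) ∧ |(sq σ k).1 p - (sq σ 0).1 p| = 1) := by
    induction k with
    | zero =>
      left
      refine ⟨?_, rfl⟩
      rw [sq_lt σ 0 (by omega)]; exact hev p
    | succ k ih =>
      have ih := ih (by omega)
      obtain ⟨q, h1, h2, h3⟩ := chain_st hN hn σ h k (by omega)
      by_cases hq : p = q
      · subst hq
        rcases ih with ⟨-, ih⟩ | ⟨ih, -⟩
        · right
          refine ⟨odd_of_st h1 h2, ?_⟩
          rw [← ih]
          rcases h2 with h2 | h2 <;> rw [h2] <;> simp
        · exact absurd h1 (Int.not_even_iff_odd.2 ih)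
      · rw [h3 p hq]; exact ih
  rcases key with ⟨-, h⟩ | ⟨-, h⟩
  · rw [h]; simp
  · exact h.le

theorem core {m n : ℕ} (hm : 1 ≤ m) (hn : n + 1 = 3 * m)
    (f : Fin (n + 1) → (Fin 3 × Fin (m + 1) → ℝ) → ℝ) (χ : Fin (n + 1) → Fin 3 → ZMod 2)
    (hc : ∀ j, ContinuousOn (f j) (Sph m))
    (heq : ∀ j, ∀ g, ∀ x ∈ Sph m, f j (actP g x) =
      (if ∑ i, χ j i * g i = 0 then 1 else -1) * f j x)
    (hcoef : MvPolynomial.coeff (Finsupp.equivFunOnFinite.symm (fun _ => m))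
      (∏ j, ∑ i, MvPolynomial.C (χ j i) * MvPolynomial.X i : MvPolynomial (Fin 3) (ZMod 2)) ≠ 0) :
    ∃ x ∈ Sph m, ∀ j, f j x = 0 := by
  classical
  by_contra! hno
  let Φ : (Fin 3 × Fin (m + 1) → ℝ) → (Fin (n + 1) → ℝ) := fun x j => f j x
  have hΦ : ContinuousOn Φ (Sph m) := continuousOn_pi.2 hc
  have hne : (Sph m).Nonempty := ⟨fun _ => 1, by simp, fun i => ⟨0, by simp⟩⟩
  obtain ⟨x₀, hx₀, hmin⟩ := (sph_compact m).exists_isMinOn hne hΦ.norm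
  set ε := ‖Φ x₀‖ with hε
  have hεpos : 0 < ε := by
    rw [hε, norm_pos_iff]
    intro h
    obtain ⟨j, hj⟩ := hno x₀ hx₀
    exact hj (congrFun h j)
  have hbig : ∀ x ∈ Sph m, ∃ j, ε ≤ |f j x| := by
    intro x hx
    by_contra! hcon
    have h1 : ‖Φ x‖ < ε := (pi_norm_lt_iff hεpos).2 hcon
    have h2 : ε ≤ ‖Φ x‖ := hmin hx
    linarith
  have huc := (sph_compact m).uniformContinuousOn_of_continuous hΦ
  rw [Metric.uniformContinuousOn_iff] at huc
  obtain ⟨δ, hδ, hd⟩ := huc ε hεpos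
  obtain ⟨N₀, hN₀⟩ := exists_nat_gt (1 / δ)
  set N := N₀ + 1 with hNdef
  have hN : 1 ≤ N := by omega
  have hN' : 1 / (2 * N : ℝ) < δ := by
    have h1 : (1 / δ : ℝ) < N := by rw [hNdef]; push_cast; linarith
    have h2 : (0 : ℝ) < N := by positivity
    rw [div_lt_iff₀ hδ] at h1
    rw [div_lt_iff₀ (by positivity)]
    nlinarith
  set S := cellSys m N n hN hn with hS
  let hh : Fin (n + 1) → Cell m N → ZMod 2 := fun j c =>
    if 0 < f j (pt c) then 1 else if f j (pt c) < 0 then 0 else lk S (χ j) c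
  have hact : ∀ g (c : Cell m N), pt (S.act g c) = actP g (pt c) := by
    intro g c
    funext p
    simp only [pt, actP, hS, cellSys, actR]
    split_ifs
    · rfl
    · push_cast; ring
  have hhact : ∀ j g c, hh j (S.act g c) = hh j c + ∑ i, χ j i * g i := by
    intro j g c
    have h1 := heq j g (pt c) (pt_mem hN c)
    have hz : ∑ i, χ j i * g i = 0 ∨ ∑ i, χ j i * g i = 1 := by
      generalize ∑ i, χ j i * g i = z; revert z; decide
    simp only [hh, hact, h1, lk_act]
    rcases hz with hz | hz
    · simp [hz]
    · rw [hz]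
      simp only [one_ne_zero, if_false, neg_mul, one_mul, Left.neg_pos_iff, Left.neg_neg_iff]
      rcases lt_trichotomy (f j (pt c)) 0 with h | h | h
      · simp [h, h.not_gt]
      · simp [h]
      · simp [h, h.not_gt]; rfl
  have hT0 : T S (List.ofFn (fun j => fun x y => hh j x + hh j y)) = 0 := by
    rw [T, tot]
    refine Finset.sum_eq_zero fun σ hσ => ?_
    have hch : IsCh S.R σ := by simpa using hσ
    by_contra hcon
    have hW := right_ne_zero_of_mul hcon
    obtain ⟨j, hj⟩ := hbig (pt (sq σ 0)) (pt_mem hN _)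
    have hconst : ∀ k < n + 2, hh j (sq σ k) = hh j (sq σ 0) := by
      intro k hk
      have hdist : dist (pt (sq σ k)) (pt (sq σ 0)) < δ := by
        refine lt_of_le_of_lt ?_ hN'
        rw [dist_pi_le_iff (by positivity)]
        intro p
        rw [Real.dist_eq]
        simp only [pt]
        rw [← sub_div, abs_div, abs_of_pos (show (0 : ℝ) < 2 * N by positivity)]
        refine div_le_div_of_nonneg_right ?_ (by positivity)
        exact_mod_cast chain_near hN hn σ hch k hk p
      have h1 := hd _ (pt_mem hN _) _ (pt_mem hN _) hdist
      have h2 : |f j (pt (sq σ k)) - f j (pt (sq σ 0))| < ε :=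
        lt_of_le_of_lt (dist_le_pi_dist (Φ (pt (sq σ k))) (Φ (pt (sq σ 0))) j) h1
      rw [abs_lt] at h2
      simp only [hh]
      rcases le_abs.1 hj with h | h
      · rw [if_pos (by linarith), if_pos (by linarith)]
      · rw [if_neg (by linarith), if_pos (by linarith), if_neg (by linarith), if_pos (by linarith)]
    have := W_ne_zero _ _ _ hW j (by simp; omega)
    apply this
    simp only [List.getElem_ofFn]
    rw [hconst j (by omega), hconst (j + 1) (by omega)]
    exact two_eq_zero' _
  have hr := T_replace S (List.ofFn (fun j => (hh j, χ j))) (by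
    intro p hp g x
    rw [List.mem_ofFn] at hp
    obtain ⟨j, rfl⟩ := hp
    exact hhact j g x) [] (by simp) (by simp)
  have hcf := T_coeff S _ (h0_cell hN hn hm) (List.ofFn χ) [] (by simp)
  simp only [List.map_ofFn, List.nil_append, List.map_nil, List.prod_nil, one_mul, List.prod_ofFn] at hr hcf
  apply hcoef
  exact hcf.symm.trans (hr.symm.trans hT0)

end EP

namespace EP

theorem core' {ι : Type} [Fintype ι] {m : ℕ} (hm : 1 ≤ m) (hn : Fintype.card ι = 3 * m)
    (f : ι → (Fin 3 × Fin (m + 1) → ℝ) → ℝ) (χ : ι → Fin 3 → ZMod 2)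
    (hc : ∀ j, ContinuousOn (f j) (Sph m))
    (heq : ∀ j, ∀ g, ∀ x ∈ Sph m, f j (actP g x) =
      (if ∑ i, χ j i * g i = 0 then 1 else -1) * f j x)
    (hcoef : MvPolynomial.coeff (Finsupp.equivFunOnFinite.symm (fun _ => m))
      (∏ j, ∑ i, MvPolynomial.C (χ j i) * MvPolynomial.X i : MvPolynomial (Fin 3) (ZMod 2)) ≠ 0) :
    ∃ x ∈ Sph m, ∀ j, f j x = 0 := by
  have hn' : Fintype.card ι = (3 * m - 1) + 1 := by omega
  let e := Fintype.equivFinOfCardEq hn'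
  obtain ⟨x, hx, h⟩ := core (n := 3 * m - 1) hm (by omega) (fun j => f (e.symm j))
    (fun j => χ (e.symm j)) (fun j => hc _) (fun j => heq _) (by
      rwa [Equiv.prod_comp e.symm (fun j => (∑ i, MvPolynomial.C (χ j i) * MvPolynomial.X i :
        MvPolynomial (Fin 3) (ZMod 2)))])
  exact ⟨x, hx, fun j => by simpa using h (e j)⟩

/-! ### The character polynomial -/

/-- characters of the three sign products -/
def sc : Fin 3 → Fin 3 → ZMod 2 := ![![0, 1, 0], ![0, 0, 1], ![0, 1, 1]]

abbrev Idx := (Fin 3 × (Fin 6 ⊕ Fin 5)) ⊕ Fin 3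

def chi : Idx → Fin 3 → ZMod 2
  | Sum.inl (s, Sum.inl _) => sc s
  | Sum.inl (s, Sum.inr _) => sc s + ![1, 0, 0]
  | Sum.inr _ => sc 1

open MvPolynomial in
lemma chi_coeff : MvPolynomial.coeff (Finsupp.equivFunOnFinite.symm (fun _ => 12))
      (∏ j, ∑ i, MvPolynomial.C (chi j i) * MvPolynomial.X i : MvPolynomial (Fin 3) (ZMod 2)) ≠ 0 := by
  have h2 : (2 : MvPolynomial (Fin 3) (ZMod 2)) = 0 := CharTwo.two_eq_zero
  have hprod : (∏ j, ∑ i, C (chi j i) * X i : MvPolynomial (Fin 3) (ZMod 2)) =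
      (X 1) ^ 6 * (X 0 + X 1) ^ 5 * ((X 2) ^ 6 * (X 0 + X 2) ^ 5) *
        ((X 1 + X 2) ^ 6 * (X 0 + X 1 + X 2) ^ 5) * (X 2) ^ 3 := by
    simp [Fintype.prod_sum_type, Fintype.prod_prod_type, Fin.prod_univ_three, Fin.sum_univ_three,
      chi, sc]
  set a : MvPolynomial (Fin 3) (ZMod 2) := X 0
  set b : MvPolynomial (Fin 3) (ZMod 2) := X 1
  set c : MvPolynomial (Fin 3) (ZMod 2) := X 2
  have hb6 : (b + c) ^ 6 = b ^ 6 + b ^ 4 * c ^ 2 + b ^ 2 * c ^ 4 + c ^ 6 := by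
    linear_combination (3 * b ^ 5 * c + 7 * b ^ 4 * c ^ 2 + 10 * b ^ 3 * c ^ 3 + 7 * b ^ 2 * c ^ 4
      + 3 * b * c ^ 5) * h2
  set K := a ^ 2 + b ^ 2 + c ^ 2 + b * c with hK
  set E := a * K + b ^ 2 * c + b * c ^ 2 with hE
  have hE1 : (a + b) * (a + c) * (a + b + c) = E := by
    rw [hE, hK]
    linear_combination (a ^ 2 * b + a ^ 2 * c + a * b * c) * h2
  set V := a ^ 4 * b ^ 4 + a ^ 4 * c ^ 4 + b ^ 4 * c ^ 4 + c ^ 8 with hV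
  set Z := a ^ 4 * c ^ 4 with hZ
  have hE4 : E ^ 4 = a ^ 12 + b ^ 4 * V + c ^ 4 * Z := by
    have h4 : ∀ x y : MvPolynomial (Fin 3) (ZMod 2), (x + y) ^ 4 = x ^ 4 + y ^ 4 := by
      intro x y
      linear_combination (2 * x ^ 3 * y + 3 * x ^ 2 * y ^ 2 + 2 * x * y ^ 3) * h2
    rw [hE, h4, h4, mul_pow, hK, h4, h4, h4, hV, hZ]
    ring
  have hmain : b ^ 6 * (a + b) ^ 5 * (c ^ 6 * (a + c) ^ 5) *
        ((b + c) ^ 6 * (a + b + c) ^ 5) * c ^ 3 = a ^ 12 * b ^ 12 * c ^ 12 +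
      a ^ 13 * (K * (b ^ 12 * c ^ 9 + b ^ 10 * c ^ 11)) +
      b ^ 13 * (E * (b ^ 3 * c ^ 9 + b * c ^ 11) * V + a ^ 12 * (b * c ^ 10 + c ^ 11)) +
      c ^ 13 * ((b ^ 8 + b ^ 6 * c ^ 2) * E ^ 4 * E + (b ^ 12 + b ^ 10 * c ^ 2) * Z * E
        + a ^ 12 * b ^ 11) := by
    calc _ = b ^ 6 * c ^ 9 * (b + c) ^ 6 * ((a + b) * (a + c) * (a + b + c)) ^ 4 *
          ((a + b) * (a + c) * (a + b + c)) := by ring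
      _ = _ := by
        rw [hE1, hb6, hE4]
        clear_value V Z
        rw [hE]
        clear_value K
        ring
  have hz : ∀ (i : Fin 3) (Q : MvPolynomial (Fin 3) (ZMod 2)),
      coeff (Finsupp.equivFunOnFinite.symm (fun _ => 12)) (X i ^ 13 * Q) = 0 := by
    intro i Q
    rw [X_pow_eq_monomial, coeff_monomial_mul', if_neg]
    intro h
    have := h i
    simp at this
  rw [hprod, hmain, coeff_add, coeff_add, coeff_add, hz, hz, hz]
  have : a ^ 12 * b ^ 12 * c ^ 12 = monomial (Finsupp.equivFunOnFinite.symm (fun _ => 12)) 1 := by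
    simp only [a, b, c, X_pow_eq_monomial, monomial_mul, mul_one]
    congr 2
    ext i
    fin_cases i <;> simp
  rw [this, coeff_monomial, if_pos rfl]
  simp

end EP

namespace EP

/-! ### Measure theoretic part -/

abbrev E13 := EuclideanSpace ℝ (Fin 13)

lemma volume_hyperplane (v : E13) (s : ℝ) (hv : v ≠ 0) :
    (volume : Measure E13) {x | (inner ℝ x v : ℝ) = s} = 0 := by
  let A : AffineSubspace ℝ E13 :=
    { carrier := {x | (inner ℝ x v : ℝ) = s}
      smul_vsub_vadd_mem' := by
        intro c p₁ p₂ p₃ h1 h2 h3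
        simp only [Set.mem_ofPred_eq, vsub_eq_sub, vadd_eq_add] at *
        rw [inner_add_left, inner_smul_left, inner_sub_left, h1, h2, h3]
        simp }
  have hA : A ≠ ⊤ := by
    intro h
    have h0 : (0 : E13) ∈ A := by rw [h]; trivial
    have h1 : v ∈ A := by rw [h]; trivial
    have h0' : (inner ℝ (0 : E13) v : ℝ) = s := h0
    have h1' : (inner ℝ v v : ℝ) = s := h1
    rw [inner_zero_left] at h0'
    rw [← h0'] at h1'
    exact hv (inner_self_eq_zero.1 h1')
  exact Measure.addHaar_affineSubspace volume A hA

/-- signed side of a point with respect to an oriented hyperplane -/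
noncomputable def Sg (q : E13 × ℝ) (x : E13) : ℝ := Real.sign (q.2 - inner ℝ x q.1)

lemma Sg_neg (q : E13 × ℝ) (x : E13) : Sg (-q) x = - Sg q x := by
  unfold Sg
  rw [← Real.sign_neg]
  congr 1
  simp
  ring

lemma abs_sign_le (r : ℝ) : |Real.sign r| ≤ 1 := by
  rcases Real.sign_apply_eq r with h | h | h <;> rw [h] <;> simp

lemma Sg_one (x : E13) : Sg (0, 1) x = 1 := by
  unfold Sg; rw [Real.sign_of_pos (by simp)]

lemma measurable_sign : Measurable Real.sign := by
  unfold Real.sign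
  exact Measurable.ite measurableSet_Iio measurable_const
    (Measurable.ite measurableSet_Ioi measurable_const measurable_const)

lemma measurable_Sg (q : E13 × ℝ) : Measurable (Sg q) := by
  unfold Sg
  exact measurable_sign.comp (by fun_prop)

lemma continuousAt_sign {r : ℝ} (h : r ≠ 0) : ContinuousAt Real.sign r := by
  rcases lt_or_gt_of_ne h with h | h
  · refine (continuousAt_const (y := (-1 : ℝ))).congr ?_
    filter_upwards [gt_mem_nhds h] with y hy
    exact (Real.sign_of_neg hy).symm
  · refine (continuousAt_const (y := (1 : ℝ))).congr ?_
    filter_upwards [lt_mem_nhds h] with y hy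
    exact (Real.sign_of_pos hy).symm

lemma continuousAt_Sg (q : E13 × ℝ) (x : E13) (h : (inner ℝ x q.1 : ℝ) ≠ q.2) :
    ContinuousAt (fun q => Sg q x) q := by
  unfold Sg
  have h1 : ContinuousAt (fun q : E13 × ℝ => q.2 - inner ℝ x q.1) q := by fun_prop
  exact ContinuousAt.comp (f := fun q : E13 × ℝ => q.2 - inner ℝ x q.1)
    (continuousAt_sign (sub_ne_zero.2 h.symm)) h1

section
variable (μ : Measure E13)

/-- the basic triple integral -/
noncomputable def J (q₁ q₂ q₃ : E13 × ℝ) : ℝ := ∫ x, Sg q₁ x * Sg q₂ x * Sg q₃ x ∂μ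

lemma J_neg₁ (q₁ q₂ q₃ : E13 × ℝ) : J μ (-q₁) q₂ q₃ = - J μ q₁ q₂ q₃ := by
  unfold J
  rw [← integral_neg]
  congr 1; funext x; rw [Sg_neg]; ring

lemma J_neg₂ (q₁ q₂ q₃ : E13 × ℝ) : J μ q₁ (-q₂) q₃ = - J μ q₁ q₂ q₃ := by
  unfold J
  rw [← integral_neg]
  congr 1; funext x; rw [Sg_neg]; ring

lemma J_neg₃ (q₁ q₂ q₃ : E13 × ℝ) : J μ q₁ q₂ (-q₃) = - J μ q₁ q₂ q₃ := by
  unfold J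
  rw [← integral_neg]
  congr 1; funext x; rw [Sg_neg]; ring

lemma bound3 (q₁ q₂ q₃ : E13 × ℝ) (x : E13) : ‖Sg q₁ x * Sg q₂ x * Sg q₃ x‖ ≤ 1 := by
  rw [norm_mul, norm_mul]
  have h1 := abs_sign_le (q₁.2 - inner ℝ x q₁.1)
  have h2 := abs_sign_le (q₂.2 - inner ℝ x q₂.1)
  have h3 := abs_sign_le (q₃.2 - inner ℝ x q₃.1)
  exact mul_le_one₀ (mul_le_one₀ h1 (norm_nonneg _) h2) (norm_nonneg _) h3

variable [IsFiniteMeasure μ]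

lemma integrable3 (q₁ q₂ q₃ : E13 × ℝ) : Integrable (fun x => Sg q₁ x * Sg q₂ x * Sg q₃ x) μ := by
  refine Integrable.of_bound (C := 1) ?_ (Filter.Eventually.of_forall (bound3 q₁ q₂ q₃))
  exact (((measurable_Sg _).mul (measurable_Sg _)).mul (measurable_Sg _)).aestronglyMeasurable

lemma J_cont (hnull : ∀ v : E13, ∀ s : ℝ, (v, s) ≠ 0 → ∀ᵐ x ∂μ, (inner ℝ x v : ℝ) ≠ s)
    (q₁ q₂ q₃ : E13 × ℝ) (h1 : q₁ ≠ 0) (h2 : q₂ ≠ 0) (h3 : q₃ ≠ 0) :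
    ContinuousAt (fun q : (E13 × ℝ) × (E13 × ℝ) × (E13 × ℝ) => J μ q.1 q.2.1 q.2.2) (q₁, q₂, q₃) := by
  unfold J
  refine continuousAt_of_dominated (bound := fun _ => 1) ?_ ?_ (integrable_const _) ?_
  · exact Filter.Eventually.of_forall fun q =>
      (((measurable_Sg _).mul (measurable_Sg _)).mul (measurable_Sg _)).aestronglyMeasurable
  · exact Filter.Eventually.of_forall fun q => Filter.Eventually.of_forall (bound3 _ _ _)
  · filter_upwards [hnull _ _ h1, hnull _ _ h2, hnull _ _ h3] with x e1 e2 e3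
    have c1 : ContinuousAt (fun q : (E13 × ℝ) × (E13 × ℝ) × (E13 × ℝ) => Sg q.1 x) (q₁, q₂, q₃) :=
      ContinuousAt.comp (f := fun q : (E13 × ℝ) × (E13 × ℝ) × (E13 × ℝ) => q.1)
        (g := fun q => Sg q x) (continuousAt_Sg q₁ x e1) continuousAt_fst
    have c2 : ContinuousAt (fun q : (E13 × ℝ) × (E13 × ℝ) × (E13 × ℝ) => Sg q.2.1 x) (q₁, q₂, q₃) :=
      ContinuousAt.comp (f := fun q : (E13 × ℝ) × (E13 × ℝ) × (E13 × ℝ) => q.2.1)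
        (g := fun q => Sg q x) (continuousAt_Sg q₂ x e2) (by fun_prop)
    have c3 : ContinuousAt (fun q : (E13 × ℝ) × (E13 × ℝ) × (E13 × ℝ) => Sg q.2.2 x) (q₁, q₂, q₃) :=
      ContinuousAt.comp (f := fun q : (E13 × ℝ) × (E13 × ℝ) × (E13 × ℝ) => q.2.2)
        (g := fun q => Sg q x) (continuousAt_Sg q₃ x e3) (by fun_prop)
    exact (c1.mul c2).mul c3

/-- the distribution function of a linear functional, in signed form -/
noncomputable def Fd (q : E13 × ℝ) : ℝ := J μ q (0, 1) (0, 1)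

lemma Fd_eq (q : E13 × ℝ) : Fd μ q = ∫ x, Sg q x ∂μ := by
  simp [Fd, J, Sg_one]

lemma Fd_cont (hnull : ∀ v : E13, ∀ s : ℝ, (v, s) ≠ 0 → ∀ᵐ x ∂μ, (inner ℝ x v : ℝ) ≠ s)
    (q : E13 × ℝ) (h : q ≠ 0) : ContinuousAt (Fd μ) q := by
  have h1 := J_cont μ hnull q (0, 1) (0, 1) h (by simp) (by simp)
  exact ContinuousAt.comp (f := fun q : E13 × ℝ => (q, ((0, 1) : E13 × ℝ), ((0, 1) : E13 × ℝ))) h1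
    (by fun_prop)

lemma integrable_Sg (q : E13 × ℝ) : Integrable (Sg q) μ := by
  refine Integrable.of_bound (C := 1) (measurable_Sg q).aestronglyMeasurable
    (Filter.Eventually.of_forall fun x => ?_)
  exact abs_sign_le _

lemma Fd_mono (hpos : ∀ U : Set E13, IsOpen U → U.Nonempty → 0 < μ U) (u : E13) (hu : u ≠ 0) :
    StrictMono (fun t => Fd μ (u, t)) := by
  intro t t' htt
  set U : Set E13 := {x | t < (inner ℝ x u : ℝ) ∧ (inner ℝ x u : ℝ) < t'} with hU
  have hUo : IsOpen U := by
    have h1 : IsOpen {x : E13 | t < (inner ℝ x u : ℝ)} := isOpen_lt (by fun_prop) (by fun_prop)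
    have h2 : IsOpen {x : E13 | (inner ℝ x u : ℝ) < t'} := isOpen_lt (by fun_prop) (by fun_prop)
    exact h1.inter h2
  have huu : (inner ℝ u u : ℝ) ≠ 0 := fun h => hu (inner_self_eq_zero.1 h)
  have hUne : U.Nonempty := by
    refine ⟨(((t + t') / 2) / (inner ℝ u u : ℝ)) • u, ?_⟩
    have : (inner ℝ ((((t + t') / 2) / (inner ℝ u u : ℝ)) • u) u : ℝ) = (t + t') / 2 := by
      rw [inner_smul_left]
      simp only [conj_trivial]
      field_simp
    simp only [hU, Set.mem_ofPred_eq, this]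
    constructor <;> linarith
  have hUp : 0 < μ.real U := by
    rw [measureReal_def]
    exact ENNReal.toReal_pos (hpos U hUo hUne).ne' (measure_ne_top μ U)
  have hle : ∫ x, U.indicator (fun _ => (1 : ℝ)) x ∂μ ≤ ∫ x, (Sg (u, t') x - Sg (u, t) x) ∂μ := by
    refine integral_mono ((integrable_const _).indicator hUo.measurableSet)
      ((integrable_Sg μ _).sub (integrable_Sg μ _)) ?_
    intro x
    simp only [Sg]
    by_cases hx : x ∈ U
    · rw [Set.indicator_of_mem hx, Real.sign_of_pos (by have := hx.2; linarith),
        Real.sign_of_neg (by have := hx.1; linarith)]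
      norm_num
    · rw [Set.indicator_of_notMem hx]
      unfold Real.sign
      split_ifs <;> linarith
  rw [integral_indicator_const _ hUo.measurableSet, integral_sub (integrable_Sg μ _) (integrable_Sg μ _),
    ← Fd_eq, ← Fd_eq] at hle
  simp only [smul_eq_mul, mul_one] at hle
  simp only
  linarith

lemma Fd_top (u : E13) : Filter.Tendsto (fun t => Fd μ (u, t)) Filter.atTop (nhds (μ.real Set.univ)) := by
  have : μ.real Set.univ = ∫ x : E13, (1 : ℝ) ∂μ := by simp
  rw [this]
  simp only [Fd_eq]
  refine tendsto_integral_filter_of_dominated_convergence (fun _ => 1) ?_ ?_ (integrable_const _) ?_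
  · exact Filter.Eventually.of_forall fun t => (measurable_Sg _).aestronglyMeasurable
  · exact Filter.Eventually.of_forall fun t => Filter.Eventually.of_forall fun x => abs_sign_le _
  · refine Filter.Eventually.of_forall fun x => ?_
    refine tendsto_const_nhds.congr' ?_
    filter_upwards [Filter.eventually_gt_atTop (inner ℝ x u : ℝ)] with t ht
    unfold Sg
    rw [Real.sign_of_pos (by simpa using ht)]

lemma Fd_neg (q : E13 × ℝ) : Fd μ (-q) = - Fd μ q := J_neg₁ μ _ _ _

lemma quantile (hnull : ∀ v : E13, ∀ s : ℝ, (v, s) ≠ 0 → ∀ᵐ x ∂μ, (inner ℝ x v : ℝ) ≠ s)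
    (u : E13) (hu : u ≠ 0) (c : ℝ) (h1 : -μ.real Set.univ < c) (h2 : c < μ.real Set.univ) :
    ∃ t, Fd μ (u, t) = c := by
  have hcont : Continuous (fun t => Fd μ (u, t)) := by
    rw [continuous_iff_continuousAt]
    intro t
    exact ContinuousAt.comp (f := fun t : ℝ => (u, t)) (Fd_cont μ hnull (u, t) (by simp [hu]))
      (by fun_prop)
  refine mem_range_of_exists_le_of_exists_ge hcont ?_ ?_
  · obtain ⟨t, ht⟩ := ((Fd_top μ (-u)).eventually (lt_mem_nhds (show -c < μ.real Set.univ by linarith))).exists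
    refine ⟨-t, ?_⟩
    have := Fd_neg μ (-u, t)
    simp only [Prod.neg_mk, neg_neg] at this
    rw [this]; linarith
  · obtain ⟨t, ht⟩ := ((Fd_top μ u).eventually (lt_mem_nhds h2)).exists
    exact ⟨t, ht.le⟩

open Classical in
/-- quantile -/
noncomputable def qt (u : E13) (c : ℝ) : ℝ := if h : ∃ t, Fd μ (u, t) = c then h.choose else 0

lemma qt_cont (hnull : ∀ v : E13, ∀ s : ℝ, (v, s) ≠ 0 → ∀ᵐ x ∂μ, (inner ℝ x v : ℝ) ≠ s)
    (hpos : ∀ U : Set E13, IsOpen U → U.Nonempty → 0 < μ U)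
    (c : ℝ) (hc : ∀ u : E13, u ≠ 0 → Fd μ (u, qt μ u c) = c) (u : E13) (hu : u ≠ 0) :
    ContinuousAt (fun u => qt μ u c) u := by
  rw [Metric.continuousAt_iff']
  intro ε hε
  have hm := Fd_mono μ hpos u hu
  have ha : Fd μ (u, qt μ u c - ε) < c := by
    have := hm (show qt μ u c - ε < qt μ u c by linarith)
    simp only [hc u hu] at this; exact this
  have hb : c < Fd μ (u, qt μ u c + ε) := by
    have := hm (show qt μ u c < qt μ u c + ε by linarith)
    simp only [hc u hu] at this; exact this
  have ct : ∀ t : ℝ, ContinuousAt (fun y : E13 => Fd μ (y, t)) u := fun t =>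
    ContinuousAt.comp (f := fun y : E13 => (y, t)) (Fd_cont μ hnull (u, t) (by simp [hu]))
      (by fun_prop)
  filter_upwards [(ct _).eventually (gt_mem_nhds ha), (ct _).eventually (lt_mem_nhds hb),
    isOpen_ne.mem_nhds hu] with y h1 h2 h3
  have hmy := Fd_mono μ hpos y h3
  have e0 := hc y h3
  have e1 : qt μ u c - ε < qt μ y c := hmy.lt_iff_lt.1 (h1.trans_eq e0.symm)
  have e2 : qt μ y c < qt μ u c + ε := hmy.lt_iff_lt.1 (e0.trans_lt h2)
  rw [Real.dist_eq, abs_lt]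
  constructor <;> linarith

end
end EP

namespace EP

section
variable (μ : Measure E13) [IsFiniteMeasure μ]

noncomputable def cq (k : ℕ) : ℝ := (2 * k / 11 - 1) * μ.real Set.univ

open Classical in
noncomputable def qk (u : E13) (k : ℕ) : E13 × ℝ :=
  if k = 0 then (0, -1) else if k = 11 then (0, 1) else (u, qt μ u (cq μ k))

lemma qk_ne (u : E13) (hu : u ≠ 0) (k : ℕ) : qk μ u k ≠ 0 := by
  unfold qk
  split_ifs <;> simp [hu]


lemma mass_pos (hpos : ∀ U : Set E13, IsOpen U → U.Nonempty → 0 < μ U) : 0 < μ.real Set.univ := by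
  rw [measureReal_def]
  exact ENNReal.toReal_pos (hpos _ isOpen_univ Set.univ_nonempty).ne' (measure_ne_top μ _)

lemma qt_spec
    (hnull : ∀ v : E13, ∀ s : ℝ, (v, s) ≠ 0 → ∀ᵐ x ∂μ, (inner ℝ x v : ℝ) ≠ s)
    (hpos : ∀ U : Set E13, IsOpen U → U.Nonempty → 0 < μ U) (u : E13) (hu : u ≠ 0) (k : ℕ) (h0 : 1 ≤ k) (h1 : k ≤ 10) :
    Fd μ (u, qt μ u (cq μ k)) = cq μ k := by
  have hM := mass_pos μ hpos
  have e0 : (1 : ℝ) ≤ k := by exact_mod_cast h0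
  have e1 : (k : ℝ) ≤ 10 := by exact_mod_cast h1
  have h : ∃ t, Fd μ (u, t) = cq μ k := by
    apply quantile μ hnull u hu
    · unfold cq; nlinarith
    · unfold cq; nlinarith
  unfold qt
  rw [dif_pos h]
  exact h.choose_spec

lemma Fd_qk
    (hnull : ∀ v : E13, ∀ s : ℝ, (v, s) ≠ 0 → ∀ᵐ x ∂μ, (inner ℝ x v : ℝ) ≠ s)
    (hpos : ∀ U : Set E13, IsOpen U → U.Nonempty → 0 < μ U) (u : E13) (hu : u ≠ 0) (k : ℕ) (h1 : k ≤ 11) : Fd μ (qk μ u k) = cq μ k := by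
  unfold qk
  split_ifs with h2 h3
  · rw [Fd_eq, h2]
    have : ∀ x, Sg (0, -1) x = -1 := fun x => by
      unfold Sg; rw [Real.sign_of_neg (by simp)]
    simp [this, cq]
  · rw [Fd_eq, h3]
    simp only [Sg_one, cq]
    simp
    ring
  · exact qt_spec μ hnull hpos u hu k (by omega) (by omega)

lemma qk_neg
    (hnull : ∀ v : E13, ∀ s : ℝ, (v, s) ≠ 0 → ∀ᵐ x ∂μ, (inner ℝ x v : ℝ) ≠ s)
    (hpos : ∀ U : Set E13, IsOpen U → U.Nonempty → 0 < μ U) (u : E13) (hu : u ≠ 0) (k : ℕ) (h1 : k ≤ 11) : qk μ (-u) k = - qk μ u (11 - k) := by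
  unfold qk
  by_cases h2 : k = 0
  · subst h2; simp
  · by_cases h3 : k = 11
    · subst h3; simp
    · rw [if_neg h2, if_neg h3, if_neg (by omega), if_neg (by omega), Prod.neg_mk]
      congr 1
      apply (Fd_mono μ hpos (-u) (by simpa using hu)).injective
      simp only
      rw [qt_spec μ hnull hpos (-u) (by simpa using hu) k (by omega) (by omega), ← Prod.neg_mk,
        Fd_neg, qt_spec μ hnull hpos u hu (11 - k) (by omega) (by omega)]
      unfold cq
      rw [Nat.cast_sub h1]
      push_cast
      ring

lemma qk_cont
    (hnull : ∀ v : E13, ∀ s : ℝ, (v, s) ≠ 0 → ∀ᵐ x ∂μ, (inner ℝ x v : ℝ) ≠ s)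
    (hpos : ∀ U : Set E13, IsOpen U → U.Nonempty → 0 < μ U) (u : E13) (hu : u ≠ 0) (k : ℕ) (h1 : k ≤ 11) : ContinuousAt (fun u => qk μ u k) u := by
  unfold qk
  split_ifs with h2 h3
  · exact continuousAt_const
  · exact continuousAt_const
  · exact continuousAt_id.prodMk (qt_cont μ hnull hpos _
      (fun u hu => qt_spec μ hnull hpos u hu k (by omega) (by omega)) u hu)

abbrev Pt := Fin 3 × Fin (12 + 1) → ℝ

noncomputable def uu (x : Pt) : E13 := WithLp.toLp 2 (fun i => x (0, i))

noncomputable def bq (j : Fin 3) (x : Pt) : E13 × ℝ :=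
  (WithLp.toLp 2 (fun i => if i = Fin.last 12 then 0 else x (j, i)), x (j, Fin.last 12))

lemma uu_cont : Continuous uu := by
  unfold uu
  refine (PiLp.continuous_toLp 2 _).comp ?_
  fun_prop

lemma bq_cont (j : Fin 3) : Continuous (bq j) := by
  unfold bq
  refine Continuous.prodMk ((PiLp.continuous_toLp 2 _).comp ?_) (by fun_prop)
  refine continuous_pi fun i => ?_
  split_ifs <;> fun_prop

lemma uu_ne (x : Pt) (hx : x ∈ Sph 12) : uu x ≠ 0 := by
  intro h
  obtain ⟨k, hk⟩ := hx.2 0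
  have : uu x k = 0 := by rw [h]; rfl
  have h' : x (0, k) = 0 := this
  rw [h'] at hk; simp at hk

lemma bq_ne (j : Fin 3) (x : Pt) (hx : x ∈ Sph 12) : bq j x ≠ 0 := by
  intro h
  obtain ⟨k, hk⟩ := hx.2 j
  have h1 : (bq j x).1 k = 0 := by rw [h]; rfl
  have h2 : (bq j x).2 = 0 := by rw [h]; rfl
  have h1' : (if k = Fin.last 12 then 0 else x (j, k)) = 0 := h1
  have h2' : x (j, Fin.last 12) = 0 := h2
  split_ifs at h1' with h
  · subst h; rw [h2'] at hk; simp at hk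
  · rw [h1'] at hk; simp at hk

lemma uu_act (g : Fin 3 → ZMod 2) (x : Pt) : uu (actP g x) = if g 0 = 0 then uu x else - uu x := by
  ext i
  split_ifs with h <;> simp [uu, actP, h]

lemma bq_act (j : Fin 3) (g : Fin 3 → ZMod 2) (x : Pt) :
    bq j (actP g x) = if g j = 0 then bq j x else - bq j x := by
  split_ifs with h
  · simp [bq, actP, h]
  · unfold bq
    rw [Prod.neg_mk]
    congr 1
    · ext i
      simp only [actP, h, if_false, PiLp.neg_apply]
      split_ifs <;> simp
    · simp [actP, h]

/-- the pair of oriented hyperplanes entering the `s`-th sign product -/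
noncomputable def PP (s : Fin 3) (x : Pt) : (E13 × ℝ) × (E13 × ℝ) :=
  ![(bq 1 x, (0, 1)), ((0, 1), bq 2 x), (bq 1 x, bq 2 x)] s

noncomputable def JP (s : Fin 3) (x : Pt) (q : E13 × ℝ) : ℝ := J μ q (PP s x).1 (PP s x).2

noncomputable def sgz (z : ZMod 2) : ℝ := if z = 0 then 1 else -1

lemma sgz_add (y z : ZMod 2) : sgz (y + z) = sgz y * sgz z := by
  have : ∀ z : ZMod 2, z = 0 ∨ z = 1 := by decide
  rcases this y with rfl | rfl <;> rcases this z with rfl | rfl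
  · simp [sgz]
  · simp [sgz]
  · simp [sgz]
  · rw [two_eq_zero']; simp [sgz]

lemma JP_act (s : Fin 3) (g : Fin 3 → ZMod 2) (x : Pt) (q : E13 × ℝ) :
    JP μ s (actP g x) q = sgz (∑ i, sc s i * g i) * JP μ s x q := by
  have hs : sgz (∑ i, sc s i * g i) = sgz (sc s 0 * g 0) * sgz (sc s 1 * g 1) * sgz (sc s 2 * g 2) := by
    rw [Fin.sum_univ_three, sgz_add, sgz_add]
  rw [hs]
  fin_cases s
  · simp [JP, PP, bq_act, sc, sgz]
    split_ifs <;> simp [J_neg₂]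
  · simp [JP, PP, bq_act, sc, sgz]
    split_ifs <;> simp [J_neg₃]
  · simp [JP, PP, bq_act, sc, sgz]
    split_ifs <;> simp [J_neg₂, J_neg₃]

/-- test functions -/
noncomputable def ff : Idx → Pt → ℝ
  | Sum.inl (s, Sum.inl k) => fun x => JP μ s x (qk μ (uu x) k) - JP μ s x (qk μ (uu x) (11 - k))
  | Sum.inl (s, Sum.inr k) => fun x =>
      JP μ s x (qk μ (uu x) (k + 1)) + JP μ s x (qk μ (uu x) (11 - (k + 1)))
  | Sum.inr r => fun x => x (2, ⟨r, by omega⟩)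

lemma JP_neg (s : Fin 3) (x : Pt) (q : E13 × ℝ) : JP μ s x (-q) = - JP μ s x q := J_neg₁ μ _ _ _

lemma PP_cont (s : Fin 3) : Continuous (PP s) := by
  have h1 := bq_cont 1
  have h2 := bq_cont 2
  fin_cases s
  · exact h1.prodMk continuous_const
  · exact Continuous.prodMk continuous_const h2
  · exact h1.prodMk h2

lemma PP_ne (s : Fin 3) (x : Pt) (hx : x ∈ Sph 12) : (PP s x).1 ≠ 0 ∧ (PP s x).2 ≠ 0 := by
  have h1 := bq_ne 1 x hx
  have h2 := bq_ne 2 x hx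
  fin_cases s <;> simp [PP, h1, h2]

lemma JP_cont
    (hnull : ∀ v : E13, ∀ s : ℝ, (v, s) ≠ 0 → ∀ᵐ x ∂μ, (inner ℝ x v : ℝ) ≠ s)
    (hpos : ∀ U : Set E13, IsOpen U → U.Nonempty → 0 < μ U) (s : Fin 3) (k : ℕ) (hk : k ≤ 11) :
    ContinuousOn (fun x => JP μ s x (qk μ (uu x) k)) (Sph 12) := by
  intro x hx
  apply ContinuousAt.continuousWithinAt
  obtain ⟨h2, h3⟩ := PP_ne s x hx
  have hJ := J_cont μ hnull (qk μ (uu x) k) (PP s x).1 (PP s x).2 (qk_ne μ _ (uu_ne x hx) k) h2 h3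
  have hq : ContinuousAt (fun x => qk μ (uu x) k) x :=
    ContinuousAt.comp (f := uu) (g := fun u => qk μ u k)
      (qk_cont μ hnull hpos (uu x) (uu_ne x hx) k hk) uu_cont.continuousAt
  exact ContinuousAt.comp (f := fun x => (qk μ (uu x) k, (PP s x).1, (PP s x).2)) hJ
    (hq.prodMk ((PP_cont s).continuousAt.fst.prodMk (PP_cont s).continuousAt.snd))

lemma exists_zero
    (hnull : ∀ v : E13, ∀ s : ℝ, (v, s) ≠ 0 → ∀ᵐ x ∂μ, (inner ℝ x v : ℝ) ≠ s)
    (hpos : ∀ U : Set E13, IsOpen U → U.Nonempty → 0 < μ U) : ∃ x ∈ Sph 12, ∀ j, ff μ j x = 0 := by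
  refine core' (by norm_num) (by simp [Idx]) (ff μ) chi ?_ ?_ chi_coeff
  · rintro (⟨s, k | k⟩ | r)
    · exact (JP_cont μ hnull hpos s _ (by omega)).sub (JP_cont μ hnull hpos s _ (by omega))
    · exact (JP_cont μ hnull hpos s _ (by omega)).add (JP_cont μ hnull hpos s _ (by omega))
    · exact (continuous_apply _).continuousOn
  · rintro (⟨s, k | k⟩ | r) g x hx
    · change _ = sgz (∑ i, sc s i * g i) * _
      simp only [ff, JP_act, uu_act]
      split_ifs with h
      · ring
      · rw [qk_neg μ hnull hpos _ (uu_ne x hx) _ (by omega), qk_neg μ hnull hpos _ (uu_ne x hx) _ (by omega),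
          JP_neg, JP_neg, show 11 - (11 - (k : ℕ)) = k by omega]
        ring
    · change _ = sgz (∑ i, (sc s + ![1, 0, 0] : Fin 3 → ZMod 2) i * g i) * _
      have : ∑ i, (sc s + ![1, 0, 0] : Fin 3 → ZMod 2) i * g i = ∑ i, sc s i * g i + g 0 := by
        simp [Fin.sum_univ_three]; ring
      rw [this, sgz_add]
      simp only [ff, JP_act, uu_act]
      split_ifs with h
      · have h1 : sgz (g 0) = 1 := if_pos h
        rw [h1]; ring
      · have h1 : sgz (g 0) = -1 := if_neg h
        rw [qk_neg μ hnull hpos _ (uu_ne x hx) _ (by omega), qk_neg μ hnull hpos _ (uu_ne x hx) _ (by omega),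
          JP_neg, JP_neg, show 11 - (11 - ((k : ℕ) + 1)) = k + 1 by omega]
        rw [h1]; ring
    · simp only [ff, chi, sc, Fin.sum_univ_three, actP]
      simp

lemma exists_balanced
    (hnull : ∀ v : E13, ∀ s : ℝ, (v, s) ≠ 0 → ∀ᵐ x ∂μ, (inner ℝ x v : ℝ) ≠ s)
    (hpos : ∀ U : Set E13, IsOpen U → U.Nonempty → 0 < μ U) : ∃ (u : E13) (qv qw : E13 × ℝ), u ≠ 0 ∧ qv ≠ 0 ∧ qw ≠ 0 ∧
    ∀ k ≤ 11, J μ (qk μ u k) (0, 1) (0, 1) = cq μ k ∧ J μ (qk μ u k) qv (0, 1) = 0 ∧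
      J μ (qk μ u k) (0, 1) qw = 0 ∧ J μ (qk μ u k) qv qw = 0 := by
  obtain ⟨x, hx, h⟩ := exists_zero μ hnull hpos
  refine ⟨uu x, bq 1 x, bq 2 x, uu_ne x hx, bq_ne 1 x hx, bq_ne 2 x hx, ?_⟩
  have key : ∀ s, ∀ k ≤ 5, JP μ s x (qk μ (uu x) k) = 0 ∧ JP μ s x (qk μ (uu x) (11 - k)) = 0 := by
    intro s k hk
    have h1 : JP μ s x (qk μ (uu x) k) - JP μ s x (qk μ (uu x) (11 - k)) = 0 :=
      h (Sum.inl (s, Sum.inl ⟨k, by omega⟩))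
    have h2 : JP μ s x (qk μ (uu x) k) + JP μ s x (qk μ (uu x) (11 - k)) = 0 := by
      rcases Nat.eq_zero_or_pos k with rfl | hk'
      · have : qk μ (uu x) 0 = - qk μ (uu x) (11 - 0) := by simp [qk]
        rw [this, JP_neg]; ring
      · have := h (Sum.inl (s, Sum.inr ⟨k - 1, by omega⟩))
        simp only [ff] at this
        rwa [show k - 1 + 1 = k by omega] at this
    constructor <;> linarith
  have key' : ∀ s, ∀ k ≤ 11, JP μ s x (qk μ (uu x) k) = 0 := by
    intro s k hk
    by_cases h5 : k ≤ 5
    · exact (key s k h5).1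
    · have := (key s (11 - k) (by omega)).2
      rwa [show 11 - (11 - k) = k by omega] at this
  intro k hk
  exact ⟨Fd_qk μ hnull hpos _ (uu_ne x hx) k hk, key' 0 k hk, key' 1 k hk, key' 2 k hk⟩

end
end EP

namespace EP

lemma ind3 {X : Type*} (A B C : Set X) (x : X) :
    (A ∩ B ∩ C).indicator (fun _ => (1 : ℝ)) x = A.indicator (fun _ => (1 : ℝ)) x *
      B.indicator (fun _ => (1 : ℝ)) x * C.indicator (fun _ => (1 : ℝ)) x := by
  by_cases m1 : x ∈ A <;> by_cases m2 : x ∈ B <;> by_cases m3 : x ∈ C <;>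
    simp [m1, m2, m3]

lemma slab_meas (u : E13) (t : ℕ → ℝ) (n i : ℕ) : MeasurableSet (slab u t n i) := by
  unfold slab
  have h1 : MeasurableSet {x : E13 | t i < (inner ℝ x u : ℝ)} :=
    measurableSet_lt (by fun_prop) (by fun_prop)
  have h2 : MeasurableSet {x : E13 | (inner ℝ x u : ℝ) < t (i + 1)} :=
    measurableSet_lt (by fun_prop) (by fun_prop)
  by_cases c1 : 1 ≤ i <;> by_cases c2 : i + 1 ≤ n <;> simp only [c1, c2, true_imp_iff, false_imp_iff]
  · exact h1.inter h2
  · simpa using h1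
  · simpa using h2
  · simp

lemma halfSp_meas (v : E13) (s : ℝ) (b : Bool) : MeasurableSet (halfSp v s b) := by
  have h1 : MeasurableSet {x : E13 | (inner ℝ x v : ℝ) < s} :=
    measurableSet_lt (by fun_prop) (by fun_prop)
  have h2 : MeasurableSet {x : E13 | s < (inner ℝ x v : ℝ)} :=
    measurableSet_lt (by fun_prop) (by fun_prop)
  cases b
  · simpa [halfSp] using h2
  · simpa [halfSp] using h1

lemma halfSp_ind (q : E13 × ℝ) (b : Bool) (x : E13) (hx : (inner ℝ x q.1 : ℝ) ≠ q.2) :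
    (halfSp q.1 q.2 b).indicator (fun _ => (1 : ℝ)) x = (1 + (if b then 1 else -1) * Sg q x) / 2 := by
  classical
  rw [Set.indicator_apply]
  rcases lt_or_gt_of_ne hx with h | h
  · have : Sg q x = 1 := Real.sign_of_pos (by linarith)
    rw [this]
    cases b
    · rw [if_neg]
      · simp
      · simp [halfSp]; exact h.le
    · rw [if_pos]
      · norm_num
      · simpa [halfSp] using h
  · have : Sg q x = -1 := Real.sign_of_neg (by linarith)
    rw [this]
    cases b
    · rw [if_pos]
      · norm_num
      · simpa [halfSp] using h
    · rw [if_neg]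
      · norm_num
      · simp [halfSp]; exact h.le

section
variable (μ : Measure E13) [IsFiniteMeasure μ]

lemma slab_ind (u : E13) (t : ℕ → ℝ) (ht : ∀ k, t k = qt μ u (cq μ k))
    (hm : StrictMonoOn t (Set.Icc 1 10)) (i : ℕ) (hi : i ≤ 10) (x : E13)
    (h1 : (inner ℝ x (qk μ u i).1 : ℝ) ≠ (qk μ u i).2)
    (h2 : (inner ℝ x (qk μ u (i + 1)).1 : ℝ) ≠ (qk μ u (i + 1)).2) :
    (slab u t 10 i).indicator (fun _ => (1 : ℝ)) x = (Sg (qk μ u (i + 1)) x - Sg (qk μ u i) x) / 2 := by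
  classical
  have hq : ∀ k, 1 ≤ k → k ≤ 10 → qk μ u k = (u, t k) := by
    intro k e1 e2
    unfold qk
    rw [if_neg (by omega), if_neg (by omega), ht]
  have hS0 : Sg (qk μ u 0) x = -1 := by
    unfold Sg; rw [Real.sign_of_neg]; simp [qk]
  have hS1 : Sg (qk μ u 11) x = 1 := by
    unfold Sg; rw [Real.sign_of_pos]; simp [qk]
  rw [Set.indicator_apply]
  rcases Nat.eq_zero_or_pos i with rfl | hi0
  · rw [hS0]
    rw [zero_add, hq 1 le_rfl (by norm_num)] at h2 ⊢
    rcases lt_or_gt_of_ne h2 with h | h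
    · rw [if_pos (by simpa [slab] using h)]
      unfold Sg; rw [Real.sign_of_pos (by simpa using h)]; norm_num
    · rw [if_neg (by simpa [slab] using h.le)]
      unfold Sg; rw [Real.sign_of_neg (by simpa using h)]; norm_num
  · rw [hq i hi0 hi] at h1 ⊢
    by_cases hi10 : i = 10
    · subst hi10
      rw [hS1]
      rcases lt_or_gt_of_ne h1 with h | h
      · rw [if_neg (by simpa [slab] using h.le)]
        unfold Sg; rw [Real.sign_of_pos (by simpa using h)]; norm_num
      · rw [if_pos (by simpa [slab] using h)]
        unfold Sg; rw [Real.sign_of_neg (by simpa using h)]; norm_num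
    · rw [hq (i + 1) (by omega) (by omega)] at h2 ⊢
      have hlt : t i < t (i + 1) := hm ⟨hi0, hi⟩ ⟨by omega, by omega⟩ (by omega)
      have hmem : x ∈ slab u t 10 i ↔ t i < (inner ℝ x u : ℝ) ∧ (inner ℝ x u : ℝ) < t (i + 1) := by
        unfold slab
        constructor
        · intro h; exact ⟨h.1 hi0, h.2 (by omega)⟩
        · intro h; exact ⟨fun _ => h.1, fun _ => h.2⟩
      simp only [hmem]
      simp only at h1 h2
      unfold Sg
      simp only
      rcases lt_or_gt_of_ne h1 with h | h
      · rw [if_neg (by intro h'; linarith [h'.1]), Real.sign_of_pos (by linarith),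
          Real.sign_of_pos (by linarith)]
        norm_num
      · rcases lt_or_gt_of_ne h2 with h' | h'
        · rw [if_pos ⟨h, h'⟩, Real.sign_of_pos (by linarith), Real.sign_of_neg (by linarith)]
          norm_num
        · rw [if_neg (by intro h''; linarith [h''.2]), Real.sign_of_neg (by linarith),
            Real.sign_of_neg (by linarith)]
          norm_num

lemma box_measure (hnull : ∀ v : E13, ∀ s : ℝ, (v, s) ≠ 0 → ∀ᵐ x ∂μ, (inner ℝ x v : ℝ) ≠ s)
    (u : E13) (hu : u ≠ 0) (qv qw : E13 × ℝ) (hqv : qv ≠ 0) (hqw : qw ≠ 0)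
    (hJ : ∀ k ≤ 11, J μ (qk μ u k) (0, 1) (0, 1) = cq μ k ∧ J μ (qk μ u k) qv (0, 1) = 0 ∧
      J μ (qk μ u k) (0, 1) qw = 0 ∧ J μ (qk μ u k) qv qw = 0)
    (t : ℕ → ℝ) (ht : ∀ k, t k = qt μ u (cq μ k))
    (hm : StrictMonoOn t (Set.Icc 1 10)) (i : ℕ) (hi : i ≤ 10) (b₁ b₂ : Bool) :
    μ.real (slab u t 10 i ∩ halfSp qv.1 qv.2 b₁ ∩ halfSp qw.1 qw.2 b₂) = μ.real Set.univ / 44 := by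
  set B := slab u t 10 i ∩ halfSp qv.1 qv.2 b₁ ∩ halfSp qw.1 qw.2 b₂ with hB
  have hBm : MeasurableSet B :=
    ((slab_meas _ _ _ _).inter (halfSp_meas _ _ _)).inter (halfSp_meas _ _ _)
  set β₁ : ℝ := if b₁ then 1 else -1
  set β₂ : ℝ := if b₂ then 1 else -1
  set o : E13 × ℝ := (0, 1)
  set p := qk μ u (i + 1)
  set q := qk μ u i
  have h1 : μ.real B = ∫ x, B.indicator (fun _ => (1 : ℝ)) x ∂μ := by
    rw [integral_indicator_const _ hBm]; simp
  have h2 : ∫ x, B.indicator (fun _ => (1 : ℝ)) x ∂μ = ∫ x,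
      (1 / 8 * ((Sg p x * Sg o x * Sg o x) + β₁ * (Sg p x * Sg qv x * Sg o x)
        + β₂ * (Sg p x * Sg o x * Sg qw x) + β₁ * β₂ * (Sg p x * Sg qv x * Sg qw x))
      - 1 / 8 * ((Sg q x * Sg o x * Sg o x) + β₁ * (Sg q x * Sg qv x * Sg o x)
        + β₂ * (Sg q x * Sg o x * Sg qw x) + β₁ * β₂ * (Sg q x * Sg qv x * Sg qw x))) ∂μ := by
    apply integral_congr_ae
    filter_upwards [hnull _ _ (qk_ne μ u hu i), hnull _ _ (qk_ne μ u hu (i + 1)), hnull _ _ hqv,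
      hnull _ _ hqw] with x e1 e2 e3 e4
    have i1 := slab_ind μ u t ht hm i hi x e1 e2
    have i2 := halfSp_ind qv b₁ x e3
    have i3 := halfSp_ind qw b₂ x e4
    have : B.indicator (fun _ => (1 : ℝ)) x = (slab u t 10 i).indicator (fun _ => (1 : ℝ)) x *
        (halfSp qv.1 qv.2 b₁).indicator (fun _ => (1 : ℝ)) x *
        (halfSp qw.1 qw.2 b₂).indicator (fun _ => (1 : ℝ)) x := by
      rw [hB]
      exact ind3 _ _ _ x
    rw [this, i1, i2, i3]
    simp only [o, Sg_one]
    ring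
  have I : ∀ q₁ q₂ q₃ : E13 × ℝ, Integrable (fun x => Sg q₁ x * Sg q₂ x * Sg q₃ x) μ := integrable3 μ
  have h3 : ∀ p : E13 × ℝ, Integrable (fun x => 1 / 8 * ((Sg p x * Sg o x * Sg o x) + β₁ * (Sg p x * Sg qv x * Sg o x)
        + β₂ * (Sg p x * Sg o x * Sg qw x) + β₁ * β₂ * (Sg p x * Sg qv x * Sg qw x))) μ ∧
      ∫ x, 1 / 8 * ((Sg p x * Sg o x * Sg o x) + β₁ * (Sg p x * Sg qv x * Sg o x)
        + β₂ * (Sg p x * Sg o x * Sg qw x) + β₁ * β₂ * (Sg p x * Sg qv x * Sg qw x)) ∂μ =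
      1 / 8 * (J μ p o o + β₁ * J μ p qv o + β₂ * J μ p o qw + β₁ * β₂ * J μ p qv qw) := by
    intro p
    have a1 := I p o o
    have a2 := (I p qv o).const_mul β₁
    have a3 := (I p o qw).const_mul β₂
    have a4 := (I p qv qw).const_mul (β₁ * β₂)
    refine ⟨(((a1.add a2).add a3).add a4).const_mul _, ?_⟩
    have a12 : Integrable (fun x => (Sg p x * Sg o x * Sg o x)
        + β₁ * (Sg p x * Sg qv x * Sg o x)) μ := a1.add a2
    have a123 : Integrable (fun x => (Sg p x * Sg o x * Sg o x)
        + β₁ * (Sg p x * Sg qv x * Sg o x) + β₂ * (Sg p x * Sg o x * Sg qw x)) μ := a12.add a3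
    rw [integral_const_mul, integral_add a123 a4, integral_add a12 a3,
      integral_add a1 a2, integral_const_mul, integral_const_mul, integral_const_mul]
    rfl
  obtain ⟨j1, j2, j3, j4⟩ := hJ i (by omega)
  obtain ⟨k1, k2, k3, k4⟩ := hJ (i + 1) (by omega)
  rw [h1, h2, integral_sub (h3 p).1 (h3 q).1, (h3 p).2, (h3 q).2, j1, j2, j3, j4, k1, k2, k3, k4]
  unfold cq
  push_cast
  ring

end

lemma slab_scale (u : E13) (t : ℕ → ℝ) (n i : ℕ) (r : ℝ) (hr : 0 < r) :
    slab (r • u) (fun k => r * t k) n i = slab u t n i := by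
  ext x
  simp only [slab, Set.mem_ofPred_eq, inner_smul_right, mul_lt_mul_iff_right₀ hr]

lemma halfSp_scale (v : E13) (s : ℝ) (b : Bool) (r : ℝ) (hr : 0 < r) :
    halfSp (r • v) (r * s) b = halfSp v s b := by
  cases b <;> ext x <;> simp [halfSp, inner_smul_right, mul_lt_mul_iff_right₀ hr]

lemma halfSp_ne (v : E13) (s : ℝ) (h : ∀ b, (halfSp v s b).Nonempty) : v ≠ 0 := by
  rintro rfl
  obtain ⟨x, hx⟩ := h true
  obtain ⟨y, hy⟩ := h false
  simp [halfSp] at hx hy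
  linarith

lemma not_par_slab (u v : E13) (t : ℕ → ℝ) (s : ℝ)
    (h : ∀ i ≤ 10, ∀ b, (slab u t 10 i ∩ halfSp v s b).Nonempty) : v ≠ u ∧ v ≠ -u := by
  constructor
  · rintro rfl
    obtain ⟨x, hx, hx'⟩ := h 0 (by norm_num) false
    obtain ⟨y, hy, hy'⟩ := h 1 (by norm_num) true
    have e1 := hx.2 (by norm_num)
    have e2 := hy.1 (by norm_num)
    simp [halfSp] at hx' hy' e1
    linarith
  · rintro rfl
    obtain ⟨x, hx, hx'⟩ := h 0 (by norm_num) true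
    obtain ⟨y, hy, hy'⟩ := h 1 (by norm_num) false
    have e1 := hx.2 (by norm_num)
    have e2 := hy.1 (by norm_num)
    simp [halfSp, inner_neg_right] at hx' hy' e1
    linarith

lemma not_par_half (v w : E13) (s₁ s₂ : ℝ)
    (h : ∀ b₁ b₂, (halfSp v s₁ b₁ ∩ halfSp w s₂ b₂).Nonempty) : w ≠ v ∧ w ≠ -v := by
  constructor
  · rintro rfl
    obtain ⟨x, hx, hx'⟩ := h true false
    obtain ⟨y, hy, hy'⟩ := h false true
    simp [halfSp] at hx hx' hy hy'
    linarith
  · rintro rfl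
    obtain ⟨x, hx, hx'⟩ := h true true
    obtain ⟨y, hy, hy'⟩ := h false false
    simp [halfSp, inner_neg_right] at hx hx' hy hy'
    linarith

end EP

theorem equipartition_R13_44_boxes
    (μ : Measure (EuclideanSpace ℝ (Fin 13)))
    (f : EuclideanSpace ℝ (Fin 13) → ℝ) (hf : Integrable f)
    (hμ : ∀ A : Set (EuclideanSpace ℝ (Fin 13)), MeasurableSet A →
      μ A = ENNReal.ofReal (∫ x in A, f x))
    (hpos : ∀ U : Set (EuclideanSpace ℝ (Fin 13)), IsOpen U → U.Nonempty → 0 < μ U) :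
    ∃ (u v w : EuclideanSpace ℝ (Fin 13)) (t : ℕ → ℝ) (s₁ s₂ : ℝ),
      ‖u‖ = 1 ∧ ‖v‖ = 1 ∧ ‖w‖ = 1 ∧
      v ≠ u ∧ v ≠ -u ∧ w ≠ u ∧ w ≠ -u ∧ w ≠ v ∧ w ≠ -v ∧
      StrictMonoOn t (Set.Icc 1 10) ∧
      ∀ i ≤ 10, ∀ b₁ b₂ : Bool,
        μ (slab u t 10 i ∩ halfSp v s₁ b₁ ∩ halfSp w s₂ b₂) =
          μ Set.univ / 44 := by
  have hfin : IsFiniteMeasure μ := ⟨by rw [hμ _ MeasurableSet.univ]; exact ENNReal.ofReal_lt_top⟩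
  have hnull : ∀ v : EP.E13, ∀ s : ℝ, (v, s) ≠ 0 → ∀ᵐ x ∂μ, (inner ℝ x v : ℝ) ≠ s := by
    intro v s hvs
    by_cases hv : v = 0
    · subst hv
      refine Filter.Eventually.of_forall fun x => ?_
      rw [inner_zero_right]
      intro h
      apply hvs
      rw [← h]; rfl
    · have hm : MeasurableSet {x : EP.E13 | (inner ℝ x v : ℝ) = s} :=
        measurableSet_eq_fun (by fun_prop) (by fun_prop)
      have h0 : μ {x : EP.E13 | (inner ℝ x v : ℝ) = s} = 0 := by
        rw [hμ _ hm, setIntegral_measure_zero _ (EP.volume_hyperplane v s hv), ENNReal.ofReal_zero]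
      rw [ae_iff]
      simpa using h0
  have hM := EP.mass_pos μ hpos
  obtain ⟨u, qv, qw, hu, hqv, hqw, hJ⟩ := EP.exists_balanced μ hnull hpos
  set t : ℕ → ℝ := fun k => EP.qt μ u (EP.cq μ k) with ht
  have hmono : StrictMonoOn t (Set.Icc 1 10) := by
    intro a ha b hb hab
    apply (EP.Fd_mono μ hpos u hu).lt_iff_lt.1
    simp only [ht]
    rw [EP.qt_spec μ hnull hpos u hu a ha.1 ha.2, EP.qt_spec μ hnull hpos u hu b hb.1 hb.2]
    unfold EP.cq
    have : (a : ℝ) < b := by exact_mod_cast hab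
    exact mul_lt_mul_of_pos_right (by linarith) hM
  have hbox : ∀ i ≤ 10, ∀ b₁ b₂ : Bool,
      μ.real (slab u t 10 i ∩ halfSp qv.1 qv.2 b₁ ∩ halfSp qw.1 qw.2 b₂) = μ.real Set.univ / 44 :=
    fun i hi b₁ b₂ => EP.box_measure μ hnull u hu qv qw hqv hqw hJ t (fun _ => rfl) hmono i hi b₁ b₂
  have hne : ∀ i ≤ 10, ∀ b₁ b₂ : Bool,
      (slab u t 10 i ∩ halfSp qv.1 qv.2 b₁ ∩ halfSp qw.1 qw.2 b₂).Nonempty := by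
    intro i hi b₁ b₂
    by_contra hc
    rw [Set.not_nonempty_iff_eq_empty] at hc
    have := hbox i hi b₁ b₂
    rw [hc, measureReal_empty] at this
    linarith
  have hv : qv.1 ≠ 0 := EP.halfSp_ne qv.1 qv.2 fun b => by
    obtain ⟨x, hx⟩ := hne 0 (by norm_num) b true
    exact ⟨x, hx.1.2⟩
  have hw : qw.1 ≠ 0 := EP.halfSp_ne qw.1 qw.2 fun b => by
    obtain ⟨x, hx⟩ := hne 0 (by norm_num) true b
    exact ⟨x, hx.2⟩
  have ru : 0 < ‖u‖⁻¹ := by positivity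
  have rv : 0 < ‖qv.1‖⁻¹ := by positivity
  have rw' : 0 < ‖qw.1‖⁻¹ := by positivity
  set u' := ‖u‖⁻¹ • u with hu'
  set v' := ‖qv.1‖⁻¹ • qv.1 with hv'
  set w' := ‖qw.1‖⁻¹ • qw.1 with hw'
  have hne' : ∀ i ≤ 10, ∀ b₁ b₂ : Bool, (slab u' (fun k => ‖u‖⁻¹ * t k) 10 i ∩
      halfSp v' (‖qv.1‖⁻¹ * qv.2) b₁ ∩ halfSp w' (‖qw.1‖⁻¹ * qw.2) b₂).Nonempty := by
    intro i hi b₁ b₂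
    rw [EP.slab_scale _ _ _ _ _ ru, EP.halfSp_scale _ _ _ _ rv, EP.halfSp_scale _ _ _ _ rw']
    exact hne i hi b₁ b₂
  have n1 := EP.not_par_slab u' v' _ _ fun i hi b => (hne' i hi b true).mono fun x hx => hx.1
  have n2 := EP.not_par_slab u' w' _ _ fun i hi b =>
    (hne' i hi true b).mono fun x hx => ⟨hx.1.1, hx.2⟩
  have n3 := EP.not_par_half v' w' _ _ fun b₁ b₂ =>
    (hne' 0 (by norm_num) b₁ b₂).mono fun x hx => ⟨hx.1.2, hx.2⟩
  refine ⟨u', v', w', fun k => ‖u‖⁻¹ * t k, ‖qv.1‖⁻¹ * qv.2, ‖qw.1‖⁻¹ * qw.2,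
    norm_smul_inv_norm hu, norm_smul_inv_norm hv, norm_smul_inv_norm hw, n1.1, n1.2, n2.1, n2.2,
    n3.1, n3.2, ?_, ?_⟩
  · intro a ha b hb hab
    exact mul_lt_mul_of_pos_left (hmono ha hb hab) ru
  · intro i hi b₁ b₂
    rw [EP.slab_scale _ _ _ _ _ ru, EP.halfSp_scale _ _ _ _ rv, EP.halfSp_scale _ _ _ _ rw']
    have h := hbox i hi b₁ b₂
    rw [measureReal_def, measureReal_def] at h
    rw [← ENNReal.toReal_eq_toReal_iff' (measure_ne_top μ _)
      (ENNReal.div_ne_top (measure_ne_top μ _) (by norm_num)), h, ENNReal.toReal_div]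
    norm_num
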